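/- arXiv:2408.13133 — 3 statements merged into one kernel-verified Lean document; each statement's English description precedes it below -/
import Mathlib

section
/- Let δ ∈ (0,1) and set ℓ := log(1/δ)/(2π). The double Dirichlet series ζ(s) := Σ_{m=0}^∞ Σ_{n=1}^∞ (m² + (n/(2ℓ))²)^{−s} converges absolutely for Re(s) > 1, and there exist ε > 0 and a holomorphic function F on {s ∈ ℂ : Re(s) > −ε} \ {1/2, 1} that agrees with ζ(s) on {Re(s) > 1}. Moreover the zeta-regularized determinant exp(−F′(0)) equals −√(2/π) · (log δ) · δ^{1/12} · ∏_{n=1}^∞ (1 − δ^{2n}). -/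
open Filter Topology Set MeasureTheory Asymptotics

/-- The primitive of the Gaussian `exp (-x ^ 2)` vanishing at `0`. -/
noncomputable def gaussianPrimitive (u : ℝ) : ℝ := ∫ x in (0:ℝ)..u, Real.exp (-x ^ 2)

lemma hasDerivAt_gaussianPrimitive (u : ℝ) :
    HasDerivAt gaussianPrimitive (Real.exp (-u ^ 2)) u :=
  (Continuous.integral_hasStrictDerivAt (by fun_prop) 0 u).hasDerivAt

lemma tendsto_gaussianPrimitive_atTop :
    Tendsto gaussianPrimitive atTop (𝓝 (√Real.pi / 2)) := by
  have h := integral_gaussian_Ioi 1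
  simp only [neg_mul, one_mul, div_one] at h
  rw [← h]
  refine intervalIntegral_tendsto_integral_Ioi 0 ?_ tendsto_id
  simpa using (integrable_exp_neg_mul_sq (b := 1) one_pos).integrableOn

lemma gaussianPrimitive_neg (u : ℝ) : gaussianPrimitive (-u) = -gaussianPrimitive u := by
  have h := intervalIntegral.integral_comp_neg (a := 0) (b := u) (fun x : ℝ => Real.exp (-x ^ 2))
  simp only [neg_sq, neg_zero] at h
  rw [gaussianPrimitive, gaussianPrimitive, h, intervalIntegral.integral_symm]

lemma tendsto_gaussianPrimitive_atBot :
    Tendsto gaussianPrimitive atBot (𝓝 (-(√Real.pi / 2))) := by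
  refine (tendsto_gaussianPrimitive_atTop.comp tendsto_neg_atBot_atTop).neg.congr fun u => ?_
  simp [gaussianPrimitive_neg]

/-- A primitive of `t ^ (-3 / 2) * exp (-(c ^ 2 * t + b ^ 2 / t))` on the positive half-line. -/
noncomputable def besselPrimitive (c b t : ℝ) : ℝ :=
  b⁻¹ * (Real.exp (-(2 * c * b)) * gaussianPrimitive (c * √t - b / √t) +
    Real.exp (2 * c * b) * gaussianPrimitive (-(c * √t) - b / √t))

lemma hasDerivAt_besselPrimitive (c : ℝ) {b t : ℝ} (hb : 0 < b) (ht : 0 < t) :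
    HasDerivAt (besselPrimitive c b)
      ((t * √t)⁻¹ * Real.exp (-(c ^ 2 * t + b ^ 2 / t))) t := by
  have hs : 0 < √t := Real.sqrt_pos.2 ht
  have hsq : √t ^ 2 = t := Real.sq_sqrt ht.le
  have h1 : HasDerivAt (fun t => √t) (1 / (2 * √t)) t := Real.hasDerivAt_sqrt ht.ne'
  have h2 : HasDerivAt (fun t => b / √t) (-(b / (2 * (t * √t)))) t := by
    convert! (h1.inv hs.ne').const_mul b using 1
    rw [hsq]; field_simp
  have key (d : ℝ) : Real.exp (-(2 * d * b)) * Real.exp (-(d * √t - b / √t) ^ 2) =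
      Real.exp (-(d ^ 2 * t + b ^ 2 / t)) := by
    rw [← Real.exp_add]
    congr 1
    field_simp
    rw [hsq]
    ring
  have h3 := (hasDerivAt_gaussianPrimitive (c * √t - b / √t)).comp t ((h1.const_mul c).sub h2)
  have h4 := (hasDerivAt_gaussianPrimitive (-(c * √t) - b / √t)).comp t
    (((h1.const_mul c).neg).sub h2)
  have h5 := ((h3.const_mul (Real.exp (-(2 * c * b)))).add
    (h4.const_mul (Real.exp (2 * c * b)))).const_mul b⁻¹
  refine h5.congr_deriv ?_
  have k1 := key c
  have k2 := key (-c)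
  simp only [neg_sq, mul_neg, neg_mul, neg_neg] at k2
  rw [← mul_assoc (Real.exp _), k1, ← mul_assoc (Real.exp (2 * c * b)), k2]
  field_simp
  ring

lemma tendsto_besselPrimitive_atTop {c : ℝ} (b : ℝ) (hc : 0 < c) :
    Tendsto (besselPrimitive c b) atTop (𝓝 (b⁻¹ * (Real.exp (-(2 * c * b)) * (√Real.pi / 2) +
      Real.exp (2 * c * b) * -(√Real.pi / 2)))) := by
  have hs : Tendsto (fun t : ℝ => c * √t) atTop atTop :=
    Real.tendsto_sqrt_atTop.const_mul_atTop hc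
  have hb : Tendsto (fun t : ℝ => -(b / √t)) atTop (𝓝 (-0)) :=
    (Real.tendsto_sqrt_atTop.const_div_atTop b).neg
  refine Tendsto.const_mul _ (Tendsto.add (Tendsto.const_mul _ ?_) (Tendsto.const_mul _ ?_))
  · exact tendsto_gaussianPrimitive_atTop.comp (hs.atTop_add hb)
  · exact tendsto_gaussianPrimitive_atBot.comp
      ((tendsto_neg_atTop_atBot.comp hs).atBot_add hb)

lemma tendsto_besselPrimitive_zero (c : ℝ) {b : ℝ} (hb : 0 < b) :
    Tendsto (besselPrimitive c b) (𝓝[>] 0) (𝓝 (b⁻¹ * (Real.exp (-(2 * c * b)) *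
      -(√Real.pi / 2) + Real.exp (2 * c * b) * -(√Real.pi / 2)))) := by
  have h0 : Tendsto (fun t : ℝ => √t) (𝓝[>] 0) (𝓝[>] 0) := by
    refine tendsto_nhdsWithin_iff.2 ⟨?_, ?_⟩
    · exact (Real.continuous_sqrt.tendsto' 0 0 Real.sqrt_zero).mono_left nhdsWithin_le_nhds
    · filter_upwards [self_mem_nhdsWithin] with t ht using Real.sqrt_pos.2 ht
  have hs : Tendsto (fun t : ℝ => c * √t) (𝓝[>] 0) (𝓝 (c * 0)) :=
    (h0.mono_right nhdsWithin_le_nhds).const_mul c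
  have hb' : Tendsto (fun t : ℝ => -(b / √t)) (𝓝[>] 0) atBot :=
    tendsto_neg_atTop_atBot.comp ((tendsto_inv_nhdsGT_zero.comp h0).const_mul_atTop hb)
  refine Tendsto.const_mul _ (Tendsto.add (Tendsto.const_mul _ ?_) (Tendsto.const_mul _ ?_))
  · exact tendsto_gaussianPrimitive_atBot.comp (hs.add_atBot hb')
  · exact tendsto_gaussianPrimitive_atBot.comp (hs.neg.add_atBot hb')

lemma integrableOn_and_integral_bessel {c b : ℝ} (hc : 0 < c) (hb : 0 < b) :
    IntegrableOn (fun t : ℝ => (t * √t)⁻¹ * Real.exp (-(c ^ 2 * t + b ^ 2 / t))) (Ioi 0) ∧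
    ∫ t in Ioi (0:ℝ), (t * √t)⁻¹ * Real.exp (-(c ^ 2 * t + b ^ 2 / t)) =
      √Real.pi / b * Real.exp (-(2 * c * b)) := by
  set L := b⁻¹ * (Real.exp (-(2 * c * b)) * -(√Real.pi / 2) +
    Real.exp (2 * c * b) * -(√Real.pi / 2)) with hL
  have hcont : ContinuousWithinAt (Function.update (besselPrimitive c b) 0 L) (Ici 0) 0 := by
    rw [continuousWithinAt_update_same, Ici_sdiff_left]
    exact tendsto_besselPrimitive_zero c hb
  have hderiv : ∀ t ∈ Ioi (0:ℝ), HasDerivAt (Function.update (besselPrimitive c b) 0 L)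
      ((t * √t)⁻¹ * Real.exp (-(c ^ 2 * t + b ^ 2 / t))) t := fun t ht =>
    (hasDerivAt_besselPrimitive c hb ht).congr_of_eventuallyEq <| by
      filter_upwards [lt_mem_nhds ht] with x hx
      exact Function.update_of_ne hx.ne' _ _
  have hpos : ∀ t ∈ Ioi (0:ℝ), 0 ≤ (t * √t)⁻¹ * Real.exp (-(c ^ 2 * t + b ^ 2 / t)) := by
    intro t ht
    have : 0 < t := ht
    positivity
  have htop : Tendsto (Function.update (besselPrimitive c b) 0 L) atTop
      (𝓝 (b⁻¹ * (Real.exp (-(2 * c * b)) * (√Real.pi / 2) +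
        Real.exp (2 * c * b) * -(√Real.pi / 2)))) := by
    refine (tendsto_besselPrimitive_atTop b hc).congr' ?_
    filter_upwards [eventually_gt_atTop 0] with x hx
    exact (Function.update_of_ne hx.ne' _ _).symm
  refine ⟨integrableOn_Ioi_deriv_of_nonneg hcont hderiv hpos htop, ?_⟩
  rw [integral_Ioi_of_hasDerivAt_of_nonneg hcont hderiv hpos htop, Function.update_self, hL]
  ring

/-- The sum `∑ n ≥ 1, exp (-π n ^ 2 x)`, for `0 < x`. -/
noncomputable def thetaTail (x : ℝ) : ℝ := (HurwitzZeta.cosKernel 0 x - 1) / 2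

lemma hasSum_thetaTail {x : ℝ} (hx : 0 < x) :
    HasSum (fun n : ℕ => Real.exp (-Real.pi * ((n : ℝ) + 1) ^ 2 * x)) (thetaTail x) := by
  have h := (HurwitzZeta.hasSum_nat_cosKernel₀ 0 hx).div_const 2
  simpa [thetaTail] using h

lemma thetaTail_inv {x : ℝ} (hx : 0 < x) :
    thetaTail x⁻¹ = √x * thetaTail x + (√x - 1) / 2 := by
  have h := HurwitzZeta.evenKernel_functional_equation 0 x
  have hs : 0 < √x := Real.sqrt_pos.2 hx
  rw [HurwitzZeta.evenKernel_eq_cosKernel_of_zero, ← Real.sqrt_eq_rpow, one_div x] at h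
  rw [thetaTail, thetaTail, h]
  field_simp
  ring

lemma continuousOn_thetaTail : ContinuousOn thetaTail (Ioi 0) :=
  ((HurwitzZeta.continuousOn_cosKernel 0).sub continuousOn_const).div_const 2

lemma isBigO_atTop_thetaTail (N : ℝ) : thetaTail =O[atTop] (fun x : ℝ => x ^ N) := by
  obtain ⟨p, hp, h⟩ := HurwitzZeta.isBigO_atTop_cosKernel_sub 0
  have h' : thetaTail =O[atTop] (fun x => Real.exp (-p * x)) :=
    (h.const_mul_left 2⁻¹).congr_left fun x => by rw [thetaTail]; ring
  exact h'.trans (isLittleO_exp_neg_mul_rpow_atTop hp N).isBigO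

lemma isBigO_zero_thetaTail :
    thetaTail =O[𝓝[>] 0] (fun x : ℝ => x ^ (-(1 / 2) : ℝ)) := by
  have h1 : (fun x : ℝ => thetaTail x⁻¹) =O[𝓝[>] 0] (fun _ => (1 : ℝ)) :=
    ((isBigO_atTop_thetaTail 0).comp_tendsto tendsto_inv_nhdsGT_zero).congr_right fun x => by simp
  have hc (c : ℝ) : (fun _ : ℝ => c) =O[𝓝[>] (0 : ℝ)] (fun _ => (1 : ℝ)) :=
    isBigO_const_const c one_ne_zero _
  have h2 : (fun x : ℝ => √x) =O[𝓝[>] 0] (fun _ => (1 : ℝ)) :=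
    ((Real.continuous_sqrt.tendsto 0).mono_left nhdsWithin_le_nhds).isBigO_one ℝ
  have h3 := ((h1.add (hc (1 / 2))).add (h2.const_mul_left (-(1 / 2)))).mul
    (isBigO_refl (fun x : ℝ => x ^ (-(1 / 2) : ℝ)) (𝓝[>] 0))
  simp only [one_mul] at h3
  refine h3.congr' ?_ .rfl
  filter_upwards [self_mem_nhdsWithin] with x hx
  have hx : 0 < x := hx
  have hs : 0 < √x := Real.sqrt_pos.2 hx
  rw [thetaTail_inv hx, Real.rpow_neg hx.le, ← Real.sqrt_eq_rpow]
  field_simp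
  ring

lemma isBigO_zero_thetaTail_inv {r : ℝ} (hr : 0 < r) (N : ℝ) :
    (fun x => thetaTail (r * x)⁻¹) =O[𝓝[>] 0] (fun x : ℝ => x ^ N) := by
  have ht : Tendsto (fun x : ℝ => (r * x)⁻¹) (𝓝[>] 0) atTop := by
    simp_rw [mul_inv]
    exact tendsto_inv_nhdsGT_zero.const_mul_atTop (inv_pos.2 hr)
  refine (((isBigO_atTop_thetaTail (-N)).comp_tendsto ht).congr' .rfl ?_).trans
    (isBigO_const_mul_self (r ^ N) (fun x : ℝ => x ^ N) _)
  filter_upwards [self_mem_nhdsWithin] with x hx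
  have hx : 0 < x := hx
  simp only [Function.comp]
  rw [Real.inv_rpow (by positivity), Real.rpow_neg (by positivity), inv_inv,
    Real.mul_rpow hr.le hx.le]

lemma isBigO_atTop_thetaTail_inv {r : ℝ} (hr : 0 < r) :
    (fun x => thetaTail (r * x)⁻¹) =O[atTop] (fun x : ℝ => x ^ (1 / 2 : ℝ)) := by
  have ht : Tendsto (fun x : ℝ => (r * x)⁻¹) atTop (𝓝[>] 0) :=
    tendsto_inv_atTop_nhdsGT_zero.comp (tendsto_id.const_mul_atTop hr)
  refine ((isBigO_zero_thetaTail.comp_tendsto ht).congr' .rfl ?_).trans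
    (isBigO_const_mul_self (r ^ (1 / 2 : ℝ)) (fun x : ℝ => x ^ (1 / 2 : ℝ)) _)
  filter_upwards [eventually_gt_atTop 0] with x hx
  simp only [Function.comp]
  rw [Real.inv_rpow (by positivity), Real.rpow_neg (by positivity), inv_inv,
    Real.mul_rpow hr.le hx.le]

/-- The rapidly decaying kernel `thetaTail x * thetaTail (1 / (r x))`. -/
noncomputable def thetaCross (r x : ℝ) : ℝ := thetaTail x * thetaTail (r * x)⁻¹

lemma isBigO_atTop_thetaCross {r : ℝ} (hr : 0 < r) (N : ℝ) :
    thetaCross r =O[atTop] (fun x : ℝ => x ^ N) := by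
  refine ((isBigO_atTop_thetaTail (N - 1 / 2)).mul (isBigO_atTop_thetaTail_inv hr)).congr'
    .rfl ?_
  filter_upwards [eventually_gt_atTop 0] with x hx
  rw [← Real.rpow_add hx, sub_add_cancel]

lemma isBigO_zero_thetaCross {r : ℝ} (hr : 0 < r) (N : ℝ) :
    thetaCross r =O[𝓝[>] 0] (fun x : ℝ => x ^ N) := by
  refine (isBigO_zero_thetaTail.mul (isBigO_zero_thetaTail_inv hr (N + 1 / 2))).congr' .rfl ?_
  filter_upwards [self_mem_nhdsWithin] with x hx
  rw [← Real.rpow_add hx, neg_add_cancel_comm_assoc]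

lemma continuousOn_thetaCross {r : ℝ} (hr : 0 < r) : ContinuousOn (thetaCross r) (Ioi 0) := by
  refine continuousOn_thetaTail.mul (continuousOn_thetaTail.comp
    (ContinuousOn.inv₀ (by fun_prop) fun x hx => ?_) fun x hx => ?_)
  · exact (mul_pos hr hx).ne'
  · exact inv_pos.2 (mul_pos hr hx)

lemma locallyIntegrableOn_ofReal {f : ℝ → ℝ} (hf : ContinuousOn f (Ioi 0)) :
    LocallyIntegrableOn (fun x => (f x : ℂ)) (Ioi 0) :=
  (Complex.continuous_ofReal.comp_continuousOn hf).locallyIntegrableOn measurableSet_Ioi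

lemma mellinConvergent_thetaCross {r : ℝ} (hr : 0 < r) (s : ℂ) :
    MellinConvergent (fun x => (thetaCross r x : ℂ)) s :=
  mellinConvergent_of_isBigO_rpow (locallyIntegrableOn_ofReal (continuousOn_thetaCross hr))
    (Complex.isBigO_ofReal_left.2 (isBigO_atTop_thetaCross hr _)) (lt_add_one _)
    (Complex.isBigO_ofReal_left.2 (isBigO_zero_thetaCross hr _)) (sub_one_lt _)

lemma differentiable_mellin_thetaCross {r : ℝ} (hr : 0 < r) :
    Differentiable ℂ (mellin fun x => (thetaCross r x : ℂ)) := fun _ =>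
  mellin_differentiableAt_of_isBigO_rpow (locallyIntegrableOn_ofReal (continuousOn_thetaCross hr))
    (Complex.isBigO_ofReal_left.2 (isBigO_atTop_thetaCross hr _)) (lt_add_one _)
    (Complex.isBigO_ofReal_left.2 (isBigO_zero_thetaCross hr _)) (sub_one_lt _)

lemma mellinConvergent_thetaTail {s : ℂ} (hs : 1 / 2 < s.re) :
    MellinConvergent (fun x => (thetaTail x : ℂ)) s :=
  mellinConvergent_of_isBigO_rpow (locallyIntegrableOn_ofReal continuousOn_thetaTail)
    (Complex.isBigO_ofReal_left.2 (isBigO_atTop_thetaTail _)) (lt_add_one _)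
    (Complex.isBigO_ofReal_left.2 isBigO_zero_thetaTail) hs

lemma mellin_thetaTail {s : ℂ} (hs : 1 / 2 < s.re) :
    mellin (fun x => (thetaTail x : ℂ)) s =
      (Real.pi : ℂ) ^ (-s) * Complex.Gamma s * riemannZeta (2 * s) := by
  have h2s : 1 < (2 * s).re := by simp; linarith
  have h := hasSum_mellin_pi_mul (a := fun _ : ℕ => (1 : ℂ)) (q := fun n : ℕ => ((n : ℝ) + 1) ^ 2)
    (F := fun x => (thetaTail x : ℂ)) (s := s) (fun n => Or.inr (by positivity)) (by linarith)
    (fun t ht => by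
      simp only [one_mul]
      exact Complex.hasSum_ofReal.2 (hasSum_thetaTail ht)) ?_
  · rw [← h.tsum_eq, zeta_eq_tsum_one_div_nat_add_one_cpow h2s, ← tsum_mul_left]
    refine tsum_congr fun n => ?_
    rw [mul_one, mul_one_div]
    congr 1
    rw [Complex.cpow_ofNat_mul]
    push_cast
    rw [sq, sq, ← Nat.cast_add_one, Complex.natCast_mul_natCast_cpow]
  · have : Summable fun n : ℕ => 1 / ((n : ℝ) + 1) ^ (2 * s.re) := by
      have := (summable_nat_add_iff 1).2 (Real.summable_one_div_nat_rpow.2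
        (show 1 < 2 * s.re by linarith))
      simpa using this
    refine this.congr fun n => ?_
    rw [norm_one, Real.rpow_mul (by positivity), Real.rpow_two]

/-- The numbers `m ^ 2 + ((n + 1) a) ^ 2`, indexed by pairs `(m, n)` of natural numbers. -/
noncomputable def mixedEigenvalue (a : ℝ) (p : ℕ × ℕ) : ℝ :=
  (p.1 : ℝ) ^ 2 + (((p.2 : ℝ) + 1) * a) ^ 2

lemma mixedEigenvalue_pos {a : ℝ} (ha : 0 < a) (p : ℕ × ℕ) : 0 < mixedEigenvalue a p := by
  unfold mixedEigenvalue
  positivity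

lemma mul_le_mixedEigenvalue {a : ℝ} (ha : 0 < a) (p : ℕ × ℕ) :
    (2 + 3 / a ^ 2)⁻¹ * (((p.1 : ℝ) + 1) * ((p.2 : ℝ) + 1)) ≤ mixedEigenvalue a p := by
  rw [inv_mul_le_iff₀ (by positivity)]
  unfold mixedEigenvalue
  have h1 : (3 / a ^ 2) * (((p.2 : ℝ) + 1) * a) ^ 2 = 3 * ((p.2 : ℝ) + 1) ^ 2 := by
    field_simp
  have h2 : 0 ≤ (3 / a ^ 2) * (p.1 : ℝ) ^ 2 := by positivity
  have h3 : 0 ≤ (((p.2 : ℝ) + 1) * a) ^ 2 := by positivity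
  have h4 : (0 : ℝ) ≤ p.1 := by positivity
  have h5 : (0 : ℝ) ≤ p.2 := by positivity
  nlinarith [sq_nonneg ((p.1 : ℝ) - 1), sq_nonneg ((p.1 : ℝ) - p.2)]

lemma summable_mixedEigenvalue_rpow {a σ : ℝ} (ha : 0 < a) (hσ : 1 < σ) :
    Summable fun p : ℕ × ℕ => mixedEigenvalue a p ^ (-σ) := by
  have h1 : Summable fun n : ℕ => ((n : ℝ) + 1) ^ (-σ) := by
    simpa using (summable_nat_add_iff 1).2 (Real.summable_nat_rpow.2 (neg_lt_neg hσ))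
  have h2 := (h1.mul_of_nonneg h1 (fun n => by positivity) (fun n => by positivity)).mul_left
    ((2 + 3 / a ^ 2)⁻¹ ^ (-σ))
  refine h2.of_nonneg_of_le (fun p => (Real.rpow_pos_of_pos (mixedEigenvalue_pos ha p) _).le)
    fun p => ?_
  rw [← Real.mul_rpow (by positivity) (by positivity), ← Real.mul_rpow (by positivity)
    (by positivity)]
  exact Real.rpow_le_rpow_of_nonpos (by positivity) (mul_le_mixedEigenvalue ha p) (by linarith)

lemma hasSum_one_add_thetaTail {x : ℝ} (hx : 0 < x) :
    HasSum (fun m : ℕ => Real.exp (-Real.pi * (m : ℝ) ^ 2 * x)) (1 + thetaTail x) := by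
  rw [← hasSum_nat_add_iff' 1]
  simpa using hasSum_thetaTail hx

lemma hasSum_exp_mixedEigenvalue {a x : ℝ} (ha : 0 < a) (hx : 0 < x) :
    HasSum (fun p : ℕ × ℕ => Real.exp (-Real.pi * mixedEigenvalue a p * x))
      ((1 + thetaTail x) * thetaTail (a ^ 2 * x)) := by
  have h1 := hasSum_one_add_thetaTail hx
  have h2 := hasSum_thetaTail (show 0 < a ^ 2 * x by positivity)
  refine (h1.mul h2 (h1.summable.mul_of_nonneg h2.summable (fun _ => by positivity)
    (fun _ => by positivity))).congr_fun fun p => ?_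
  rw [← Real.exp_add, mixedEigenvalue]
  ring_nf

lemma kernel_decomposition {a x : ℝ} (ha : 0 < a) (hx : 0 < x) :
    (1 + thetaTail x) * thetaTail (a ^ 2 * x) = thetaTail (a ^ 2 * x) +
      (a⁻¹ * (x ^ (-(1 / 2) : ℝ) * thetaCross (a ^ 2) x) +
        (2 * a)⁻¹ * (x ^ (-(1 / 2) : ℝ) * thetaTail x) - 2⁻¹ * thetaTail x) := by
  have hax : 0 < a ^ 2 * x := by positivity
  have h := thetaTail_inv (inv_pos.2 hax)
  have hs : 0 < √x := Real.sqrt_pos.2 hx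
  rw [inv_inv, Real.sqrt_inv, Real.sqrt_mul (by positivity), Real.sqrt_sq ha.le] at h
  rw [Real.rpow_neg hx.le, ← Real.sqrt_eq_rpow, thetaCross, add_mul, one_mul]
  congr 1
  rw [h]
  field_simp
  ring

/-- The function `π ^ (-s) Γ(s) ζ(2s)`. -/
noncomputable def gammaZeta (s : ℂ) : ℂ :=
  (Real.pi : ℂ) ^ (-s) * Complex.Gamma s * riemannZeta (2 * s)

lemma mellin_kernel {a : ℝ} (ha : 0 < a) {s : ℂ} (hs : 1 < s.re) :
    mellin (fun x => (((1 + thetaTail x) * thetaTail (a ^ 2 * x) : ℝ) : ℂ)) s =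
      ((a ^ 2 : ℝ) : ℂ) ^ (-s) * gammaZeta s +
      ((a : ℂ)⁻¹ * mellin (fun x => (thetaCross (a ^ 2) x : ℂ)) (s - 1 / 2) +
        (2 * (a : ℂ))⁻¹ * gammaZeta (s - 1 / 2) - 2⁻¹ * gammaZeta s) := by
  have ha2 : 0 < a ^ 2 := by positivity
  have hs1 : 1 / 2 < s.re := by linarith
  have hs2 : 1 / 2 < (s + -(1 / 2)).re := by norm_num; linarith
  have hP := mellinConvergent_thetaTail hs1
  have hPa : MellinConvergent (fun x => (thetaTail (a ^ 2 * x) : ℂ)) s :=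
    (MellinConvergent.comp_mul_left (f := fun x => (thetaTail x : ℂ)) ha2).2 hP
  have hQ := (MellinConvergent.cpow_smul.2
    (mellinConvergent_thetaCross ha2 (s + -(1 / 2)))).const_smul (a : ℂ)⁻¹
  have hR := (MellinConvergent.cpow_smul.2
    (mellinConvergent_thetaTail hs2)).const_smul (2 * (a : ℂ))⁻¹
  have h1 := hasMellin_add hQ hR
  have h2 := hasMellin_sub h1.1 (hP.const_smul (2⁻¹ : ℂ))
  have h3 := hasMellin_add hPa h2.1
  have h4 := h3.2
  rw [h2.2, h1.2, mellin_const_smul, mellin_const_smul, mellin_const_smul, mellin_cpow_smul,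
    mellin_cpow_smul, mellin_comp_mul_left (fun x => (thetaTail x : ℂ)) s ha2,
    mellin_thetaTail hs1, mellin_thetaTail hs2, ← sub_eq_add_neg] at h4
  simp only [smul_eq_mul] at h4
  unfold gammaZeta
  rw [← h4]
  refine setIntegral_congr_fun measurableSet_Ioi fun x hx => ?_
  have hx : 0 < x := hx
  simp only
  rw [kernel_decomposition ha hx]
  push_cast [Complex.ofReal_cpow hx.le]
  rfl

lemma hasSum_mixedEigenvalue_cpow {a : ℝ} (ha : 0 < a) {s : ℂ} (hs : 1 < s.re) :
    HasSum (fun p : ℕ × ℕ => (Real.pi : ℂ) ^ (-s) * Complex.Gamma s *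
      (mixedEigenvalue a p : ℂ) ^ (-s))
      (mellin (fun x => (((1 + thetaTail x) * thetaTail (a ^ 2 * x) : ℝ) : ℂ)) s) := by
  refine (hasSum_mellin_pi_mul (a := fun _ : ℕ × ℕ => (1 : ℂ)) (q := mixedEigenvalue a)
    (fun p => Or.inr (mixedEigenvalue_pos ha p)) (by linarith) (fun t ht => ?_) ?_).congr_fun
    fun p => ?_
  · simp only [one_mul]
    exact Complex.hasSum_ofReal.2 (hasSum_exp_mixedEigenvalue ha ht)
  · refine (summable_mixedEigenvalue_rpow ha hs).congr fun p => ?_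
    rw [norm_one, one_div, Real.rpow_neg (mixedEigenvalue_pos ha p).le]
  · rw [mul_one, Complex.cpow_neg (mixedEigenvalue a p : ℂ), div_eq_mul_inv]

/-- The spectral zeta function of the numbers `mixedEigenvalue a p`, analytically continued. -/
noncomputable def mixedZeta (a : ℝ) (s : ℂ) : ℂ :=
  (((a ^ 2 : ℝ) : ℂ) ^ (-s) - 2⁻¹) * riemannZeta (2 * s) +
    (Complex.Gamma s)⁻¹ * ((Real.pi : ℂ) ^ s *
      ((a : ℂ)⁻¹ * mellin (fun x => (thetaCross (a ^ 2) x : ℂ)) (s - 1 / 2) +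
        (2 * (a : ℂ))⁻¹ * gammaZeta (s - 1 / 2)))

lemma mixedZeta_eq_tsum {a : ℝ} (ha : 0 < a) {s : ℂ} (hs : 1 < s.re) :
    mixedZeta a s = ∑' p : ℕ × ℕ, (mixedEigenvalue a p : ℂ) ^ (-s) := by
  have h := (hasSum_mixedEigenvalue_cpow ha hs).tsum_eq
  rw [tsum_mul_left, mellin_kernel ha hs] at h
  have hpi : (Real.pi : ℂ) ^ s ≠ 0 := by simp [Complex.cpow_eq_zero_iff, Real.pi_ne_zero]
  have hG : Complex.Gamma s ≠ 0 := Complex.Gamma_ne_zero_of_re_pos (by linarith)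
  rw [Complex.cpow_neg] at h
  rw [mixedZeta]
  rw [show gammaZeta s = ((Real.pi : ℂ) ^ s)⁻¹ * Complex.Gamma s * riemannZeta (2 * s) by
    rw [gammaZeta, Complex.cpow_neg]] at h
  generalize gammaZeta (s - 1 / 2) = G at *
  generalize mellin (fun x => (thetaCross (a ^ 2) x : ℂ)) (s - 1 / 2) = M at *
  generalize riemannZeta (2 * s) = Z at *
  generalize ∑' p : ℕ × ℕ, (mixedEigenvalue a p : ℂ) ^ (-s) = T at *
  have h' : T = (Real.pi : ℂ) ^ s * (Complex.Gamma s)⁻¹ *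
      (((Real.pi : ℂ) ^ s)⁻¹ * Complex.Gamma s * T) := by field_simp
  rw [h', h]
  field_simp
  ring

lemma differentiableAt_gammaZeta_sub_half {s : ℂ} (hs : -(1 / 2) < s.re) (h1 : s ≠ 1 / 2)
    (h2 : s ≠ 1) : DifferentiableAt ℂ (fun s => gammaZeta (s - 1 / 2)) s := by
  have hpi : (Real.pi : ℂ) ≠ 0 := Complex.ofReal_ne_zero.2 Real.pi_ne_zero
  have hG : DifferentiableAt ℂ Complex.Gamma (s - 1 / 2) := by
    refine Complex.differentiableAt_Gamma _ fun m hm => ?_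
    rcases m with _ | m
    · apply h1
      linear_combination hm
    · have := congrArg Complex.re hm
      norm_num at this
      have hm0 : (0 : ℝ) ≤ m := m.cast_nonneg
      linarith
  have hZ : DifferentiableAt ℂ riemannZeta (2 * (s - 1 / 2)) := by
    refine differentiableAt_riemannZeta fun h => h2 ?_
    linear_combination h / 2
  unfold gammaZeta
  have e1 : DifferentiableAt ℂ (fun s : ℂ => Complex.Gamma (s - 1 / 2)) s :=
    hG.comp s (by fun_prop)
  have e2 : DifferentiableAt ℂ (fun s : ℂ => riemannZeta (2 * (s - 1 / 2))) s :=
    hZ.comp (f := fun s : ℂ => 2 * (s - 1 / 2)) s (by fun_prop)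
  have e3 : DifferentiableAt ℂ (fun s : ℂ => (Real.pi : ℂ) ^ (-(s - 1 / 2))) s :=
    DifferentiableAt.const_cpow (by fun_prop) (Or.inl hpi)
  exact (e3.mul e1).mul e2

lemma differentiableAt_mixedZeta_factor {a : ℝ} (ha : 0 < a) {s : ℂ} (hs : -(1 / 2) < s.re)
    (h1 : s ≠ 1 / 2) (h2 : s ≠ 1) :
    DifferentiableAt ℂ (fun s => (Real.pi : ℂ) ^ s *
      ((a : ℂ)⁻¹ * mellin (fun x => (thetaCross (a ^ 2) x : ℂ)) (s - 1 / 2) +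
        (2 * (a : ℂ))⁻¹ * gammaZeta (s - 1 / 2))) s := by
  have hpi : (Real.pi : ℂ) ≠ 0 := Complex.ofReal_ne_zero.2 Real.pi_ne_zero
  have e1 : DifferentiableAt ℂ (fun s : ℂ => (Real.pi : ℂ) ^ s) s :=
    DifferentiableAt.const_cpow differentiableAt_id (Or.inl hpi)
  have e2 : DifferentiableAt ℂ
      (fun s : ℂ => mellin (fun x => (thetaCross (a ^ 2) x : ℂ)) (s - 1 / 2)) s :=
    (differentiable_mellin_thetaCross (show 0 < a ^ 2 by positivity) _).comp s (by fun_prop)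
  exact e1.mul ((e2.const_mul _).add ((differentiableAt_gammaZeta_sub_half hs h1 h2).const_mul _))

lemma differentiableAt_mixedZeta {a : ℝ} (ha : 0 < a) {s : ℂ} (hs : -(1 / 2) < s.re)
    (h1 : s ≠ 1 / 2) (h2 : s ≠ 1) : DifferentiableAt ℂ (mixedZeta a) s := by
  have ha2 : ((a ^ 2 : ℝ) : ℂ) ≠ 0 := Complex.ofReal_ne_zero.2 (by positivity)
  have hZ : DifferentiableAt ℂ riemannZeta (2 * s) := by
    refine differentiableAt_riemannZeta fun h => h1 ?_
    linear_combination h / 2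
  have e1 : DifferentiableAt ℂ (fun s : ℂ => ((a ^ 2 : ℝ) : ℂ) ^ (-s)) s :=
    DifferentiableAt.const_cpow (by fun_prop) (Or.inl ha2)
  have e2 : DifferentiableAt ℂ (fun s : ℂ => riemannZeta (2 * s)) s :=
    hZ.comp (f := fun s : ℂ => 2 * s) s (by fun_prop)
  exact ((e1.sub_const _).mul e2).add ((Complex.differentiable_one_div_Gamma s).mul
    (differentiableAt_mixedZeta_factor ha hs h1 h2))

lemma summable_pow_mul_div {q : ℝ} (h0 : 0 < q) (h1 : q < 1) :
    Summable fun p : ℕ × ℕ => q ^ ((p.1 + 1) * (p.2 + 1)) / ((p.2 : ℝ) + 1) := by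
  have hg := summable_geometric_of_lt_one h0.le h1
  refine (hg.mul_of_nonneg hg (fun _ => by positivity) (fun _ => by positivity)).of_nonneg_of_le
    (fun p => by positivity) fun p => ?_
  rw [← pow_add]
  refine (div_le_self (by positivity) (by simp)).trans
    (pow_le_pow_of_le_one h0.le h1.le ?_)
  nlinarith

/-- The value at `-1 / 2` of the Mellin transform of `thetaCross r`, as a real integral. -/
noncomputable def thetaCrossIntegral (r : ℝ) : ℝ :=
  ∫ x in Ioi (0 : ℝ), (x * √x)⁻¹ * thetaCross r x

lemma mellin_thetaCross_neg_half (r : ℝ) :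
    mellin (fun x => (thetaCross r x : ℂ)) (-(1 / 2)) = (thetaCrossIntegral r : ℂ) := by
  rw [thetaCrossIntegral, ← integral_complex_ofReal]
  refine setIntegral_congr_fun measurableSet_Ioi fun x hx => ?_
  have hx : 0 < x := hx
  have h : x * √x = x ^ (3 / 2 : ℝ) := by
    rw [Real.sqrt_eq_rpow]
    nth_rw 1 [← Real.rpow_one x]
    rw [← Real.rpow_add hx]
    norm_num
  simp only [smul_eq_mul]
  rw [h, ← Real.rpow_neg hx.le]
  push_cast [Complex.ofReal_cpow hx.le]
  norm_num

lemma hasSum_thetaCrossIntegral {a : ℝ} (ha : 0 < a) :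
    HasSum (fun p : ℕ × ℕ =>
      a * (Real.exp (-(2 * Real.pi / a)) ^ ((p.1 + 1) * (p.2 + 1)) / ((p.2 : ℝ) + 1)))
      (thetaCrossIntegral (a ^ 2)) := by
  have hpi := Real.pi_pos
  have hsp : 0 < √Real.pi := Real.sqrt_pos.2 hpi
  have hsq : √Real.pi ^ 2 = Real.pi := Real.sq_sqrt hpi.le
  set c : ℕ × ℕ → ℝ := fun p => √Real.pi * ((p.1 : ℝ) + 1) with hc
  set b : ℕ × ℕ → ℝ := fun p => √Real.pi * ((p.2 : ℝ) + 1) / a with hb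
  have hcpos p : 0 < c p := by positivity
  have hbpos p : 0 < b p := by positivity
  set f : ℕ × ℕ → ℝ → ℝ := fun p t =>
    (t * √t)⁻¹ * Real.exp (-(c p ^ 2 * t + b p ^ 2 / t)) with hf
  have hint p : ∫ t in Ioi (0 : ℝ), f p t =
      a * (Real.exp (-(2 * Real.pi / a)) ^ ((p.1 + 1) * (p.2 + 1)) / ((p.2 : ℝ) + 1)) := by
    rw [(integrableOn_and_integral_bessel (hcpos p) (hbpos p)).2, ← Real.exp_nat_mul]
    have : 2 * c p * b p = 2 * Real.pi / a * (((p.1 : ℝ) + 1) * ((p.2 : ℝ) + 1)) := by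
      simp only [hc, hb]
      field_simp
      rw [hsq]
    rw [this]
    simp only [hb]
    push_cast
    field_simp
  have hnorm p : ∫ t in Ioi (0 : ℝ), ‖f p t‖ = ∫ t in Ioi (0 : ℝ), f p t := by
    refine setIntegral_congr_fun measurableSet_Ioi fun t ht => ?_
    have ht : 0 < t := ht
    exact Real.norm_of_nonneg (by positivity)
  have hlt : Real.exp (-(2 * Real.pi / a)) < 1 := Real.exp_lt_one_iff.2 (by
    have : 0 < 2 * Real.pi / a := by positivity
    linarith)
  have h := hasSum_integral_of_summable_integral_norm (μ := volume.restrict (Ioi 0)) (F := f)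
    (fun p => (integrableOn_and_integral_bessel (hcpos p) (hbpos p)).1) (by
      simp_rw [hnorm, hint]
      exact (summable_pow_mul_div (Real.exp_pos _) hlt).mul_left a)
  simp_rw [hint] at h
  convert! h using 1
  refine setIntegral_congr_fun measurableSet_Ioi fun x hx => ?_
  have hx : 0 < x := hx
  have h1 := hasSum_thetaTail hx
  have h2 := hasSum_thetaTail (show 0 < (a ^ 2 * x)⁻¹ by positivity)
  have h3 := (h1.mul h2 (h1.summable.mul_of_nonneg h2.summable (fun _ => by positivity)
    (fun _ => by positivity))).mul_left (x * √x)⁻¹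
  rw [thetaCross, ← h3.tsum_eq]
  refine tsum_congr fun p => ?_
  rw [← Real.exp_add]
  simp only [hf, hc, hb]
  congr 2
  rw [mul_pow, div_pow, mul_pow, hsq]
  field_simp
  ring

lemma exp_neg_thetaCrossIntegral {a : ℝ} (ha : 0 < a) :
    Real.exp (-(a⁻¹ * thetaCrossIntegral (a ^ 2))) =
      ∏' n : ℕ, (1 - Real.exp (-(2 * Real.pi / a)) ^ (n + 1)) := by
  have hpi := Real.pi_pos
  have h0 := Real.exp_pos (-(2 * Real.pi / a))
  have h1 : Real.exp (-(2 * Real.pi / a)) < 1 := Real.exp_lt_one_iff.2 (by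
    have : 0 < 2 * Real.pi / a := by positivity
    linarith)
  have h := (hasSum_thetaCrossIntegral ha).mul_left a⁻¹
  simp_rw [inv_mul_cancel_left₀ ha.ne'] at h
  generalize Real.exp (-(2 * Real.pi / a)) = q at *
  have hq n : q ^ (n + 1) < 1 := pow_lt_one₀ h0.le h1 n.succ_ne_zero
  have h2 := (h.prod_fiberwise (g := fun m => -Real.log (1 - q ^ (m + 1))) fun m => by
    have := Real.hasSum_pow_div_log_of_abs_lt_one (x := q ^ (m + 1))
      (by rw [abs_of_pos (by positivity)]; exact hq m)
    simpa only [← pow_mul] using this).neg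
  simp only [neg_neg] at h2
  rw [← h2.tsum_eq]
  exact Real.rexp_tsum_eq_tprod (fun n => sub_pos.2 (hq n)) h2.summable

lemma gammaZeta_neg_half : gammaZeta (-(1 / 2)) = (Real.pi : ℂ) / 6 := by
  have hpi : (Real.pi : ℂ) ≠ 0 := Complex.ofReal_ne_zero.2 Real.pi_ne_zero
  have hG : (Real.pi : ℂ) ^ (1 / 2 : ℂ) = -(1 / 2) * Complex.Gamma (-(1 / 2)) := by
    rw [← Complex.Gamma_one_half_eq, ← Complex.Gamma_add_one _ (by norm_num)]
    norm_num
  have hZ : riemannZeta (-1) = -(1 / 12) := by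
    have h := riemannZeta_neg_nat_eq_bernoulli' 1
    norm_num [bernoulli'_two] at h
    rw [h]
  have hsq : (Real.pi : ℂ) ^ (1 / 2 : ℂ) * (Real.pi : ℂ) ^ (1 / 2 : ℂ) = Real.pi := by
    rw [← Complex.cpow_add _ _ hpi]
    norm_num
  rw [gammaZeta, neg_neg, show (2 : ℂ) * -(1 / 2) = -1 by norm_num, hZ]
  linear_combination (1 / 6) * hsq - (1 / 6) * (Real.pi : ℂ) ^ (1 / 2 : ℂ) * hG

lemma hasDerivAt_one_div_Gamma_zero :
    HasDerivAt (fun s : ℂ => (Complex.Gamma s)⁻¹) 1 0 := by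
  have h : (fun s : ℂ => (Complex.Gamma s)⁻¹) = fun s => s * (Complex.Gamma (s + 1))⁻¹ :=
    funext Complex.one_div_Gamma_eq_self_mul_one_div_Gamma_add_one
  have hd : DifferentiableAt ℂ (fun s : ℂ => (Complex.Gamma (s + 1))⁻¹) 0 :=
    DifferentiableAt.comp (g := fun s : ℂ => (Complex.Gamma s)⁻¹) (f := fun s : ℂ => s + 1) (0 : ℂ)
      (Complex.differentiable_one_div_Gamma (0 + 1)) (by fun_prop)
  rw [h]
  convert! (hasDerivAt_id (0 : ℂ)).mul hd.hasDerivAt using 1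
  simp

lemma hasDerivAt_mixedZeta_zero {a : ℝ} (ha : 0 < a) :
    HasDerivAt (mixedZeta a) ((Real.log a - Real.log (2 * Real.pi) / 2 +
      (a⁻¹ * thetaCrossIntegral (a ^ 2) + Real.pi / (12 * a)) : ℝ) : ℂ) 0 := by
  have ha' : (a : ℂ) ≠ 0 := Complex.ofReal_ne_zero.2 ha.ne'
  have ha2 : ((a ^ 2 : ℝ) : ℂ) ≠ 0 := Complex.ofReal_ne_zero.2 (by positivity)
  have hZ : HasDerivAt (fun s : ℂ => riemannZeta (2 * s))
      (-Complex.log (2 * Real.pi) / 2 * 2) 0 := by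
    have h0 : HasDerivAt riemannZeta (-Complex.log (2 * Real.pi) / 2) (2 * 0) := by
      rw [mul_zero, ← deriv_riemannZeta_zero]
      exact (differentiableAt_riemannZeta zero_ne_one).hasDerivAt
    exact HasDerivAt.comp (h := fun s : ℂ => 2 * s) (0 : ℂ) h0
      (by simpa using (hasDerivAt_id (0 : ℂ)).const_mul 2)
  have hA : HasDerivAt (fun s : ℂ => ((a ^ 2 : ℝ) : ℂ) ^ (-s) - 2⁻¹)
      (-Complex.log ((a ^ 2 : ℝ) : ℂ)) 0 := by
    have := ((hasDerivAt_id (0 : ℂ)).neg.const_cpow (c := ((a ^ 2 : ℝ) : ℂ)) (Or.inl ha2)).sub_const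
      (2⁻¹ : ℂ)
    simpa using this
  have hH := (differentiableAt_mixedZeta_factor ha (s := 0) (by norm_num) (by norm_num)
    (by norm_num)).hasDerivAt
  have h := (hA.mul hZ).add (hasDerivAt_one_div_Gamma_zero.mul hH)
  refine h.congr_deriv ?_
  have hl : Complex.log ((a ^ 2 : ℝ) : ℂ) = 2 * (Real.log a : ℂ) := by
    rw [← Complex.ofReal_log (by positivity), Real.log_pow]
    push_cast
    ring
  have hl2 : Complex.log (2 * Real.pi) = (Real.log (2 * Real.pi) : ℂ) := by
    rw [Complex.ofReal_log (by positivity)]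
    push_cast
    rfl
  rw [hl, hl2, mul_zero, riemannZeta_zero, Complex.Gamma_zero, neg_zero, Complex.cpow_zero,
    Complex.cpow_zero, zero_sub, gammaZeta_neg_half, mellin_thetaCross_neg_half]
  push_cast
  field_simp
  ring

lemma exp_neg_deriv_mixedZeta {a : ℝ} (ha : 0 < a) :
    Complex.exp (-deriv (mixedZeta a) 0) =
      ((a⁻¹ * √(2 * Real.pi) * Real.exp (-(Real.pi / (12 * a))) *
        ∏' n : ℕ, (1 - Real.exp (-(2 * Real.pi / a)) ^ (n + 1)) : ℝ) : ℂ) := by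
  have hpi := Real.pi_pos
  rw [(hasDerivAt_mixedZeta_zero ha).deriv, ← Complex.ofReal_neg, ← Complex.ofReal_exp,
    ← exp_neg_thetaCrossIntegral ha]
  congr 1
  have h1 : a⁻¹ = Real.exp (-Real.log a) := by rw [Real.exp_neg, Real.exp_log ha]
  have h2 : √(2 * Real.pi) = Real.exp (Real.log (2 * Real.pi) / 2) := by
    rw [← Real.log_sqrt (by positivity), Real.exp_log (by positivity)]
  rw [h2]
  nth_rw 2 [h1]
  rw [← Real.exp_add, ← Real.exp_add, ← Real.exp_add]
  ring_nf

/-- Determinant of the Laplacian with mixed boundary conditions on the half-annulus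
`𝔸_δ⁺` (eigenvalues `m² + (n/(2ℓ))²`, `m ≥ 0`, `n ≥ 1`) via zeta regularization. -/
theorem det_halfAnnulus_mixed (δ : ℝ) (hδ : δ ∈ Set.Ioo (0:ℝ) 1) (ℓ : ℝ)
    (hℓ : ℓ = Real.log (1/δ) / (2 * Real.pi)) :
    (∀ s : ℂ, 1 < s.re →
      Summable (fun p : ℕ × ℕ =>
        ‖((((p.1 : ℝ)^2 + (((p.2 : ℝ) + 1) / (2 * ℓ))^2 : ℝ)) : ℂ) ^ (-s)‖)) ∧
    ∃ ε : ℝ, 0 < ε ∧ ∃ F : ℂ → ℂ,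
      DifferentiableOn ℂ F ({s : ℂ | -ε < s.re} \ {1/2, 1}) ∧
      (∀ s : ℂ, 1 < s.re →
        F s = ∑' p : ℕ × ℕ,
          ((((p.1 : ℝ)^2 + (((p.2 : ℝ) + 1) / (2 * ℓ))^2 : ℝ)) : ℂ) ^ (-s)) ∧
      Complex.exp (-(deriv F 0)) =
        ((- Real.sqrt (2 / Real.pi) * Real.log δ * δ ^ ((1:ℝ)/12) *
          ∏' n : ℕ, (1 - δ ^ (2 * (n + 1))) : ℝ) : ℂ) := by
  obtain ⟨hδ0, hδ1⟩ := hδ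
  have hpi := Real.pi_pos
  have hlog : Real.log δ < 0 := Real.log_neg hδ0 hδ1
  have hℓ' : 2 * ℓ = -Real.log δ / Real.pi := by
    rw [hℓ, one_div, Real.log_inv]
    field_simp
  have ha : 0 < (2 * ℓ)⁻¹ := by
    rw [hℓ']
    have : 0 < -Real.log δ := neg_pos.2 hlog
    positivity
  have heig (p : ℕ × ℕ) : (p.1 : ℝ) ^ 2 + (((p.2 : ℝ) + 1) / (2 * ℓ)) ^ 2 =
      mixedEigenvalue (2 * ℓ)⁻¹ p := by
    rw [mixedEigenvalue, div_eq_mul_inv]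
  simp_rw [heig]
  refine ⟨fun s hs => ?_, 1 / 2, by norm_num, mixedZeta (2 * ℓ)⁻¹, ?_,
    fun s hs => mixedZeta_eq_tsum ha hs, ?_⟩
  · refine (summable_mixedEigenvalue_rpow ha hs).congr fun p => ?_
    rw [Complex.norm_cpow_eq_rpow_re_of_pos (mixedEigenvalue_pos ha p), Complex.neg_re]
  · rintro s ⟨hs, hs'⟩
    rw [mem_insert_iff, mem_singleton_iff, not_or] at hs'
    exact (differentiableAt_mixedZeta ha hs hs'.1 hs'.2).differentiableWithinAt
  · rw [exp_neg_deriv_mixedZeta ha]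
    congr 1
    have hq : Real.exp (-(2 * Real.pi / (2 * ℓ)⁻¹)) = δ ^ 2 := by
      rw [hℓ', div_inv_eq_mul, ← Real.exp_log (pow_pos hδ0 2), Real.log_pow]
      congr 1
      field_simp
      norm_num
      ring
    have hδ12 : Real.exp (-(Real.pi / (12 * (2 * ℓ)⁻¹))) = δ ^ ((1 : ℝ) / 12) := by
      rw [hℓ', Real.rpow_def_of_pos hδ0]
      congr 1
      field_simp
    have hsqrt : √(2 * Real.pi) = √(2 / Real.pi) * Real.pi := by
      rw [← Real.sqrt_mul_self hpi.le, ← Real.sqrt_mul (by positivity), Real.sqrt_mul_self hpi.le]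
      congr 1
      field_simp
    simp_rw [hq, hδ12, ← pow_mul, hsqrt, inv_inv]
    congr 2
    rw [hℓ']
    field_simp
end

section
/- Let δ ∈ (0,1) and set ℓ := log(1/δ)/(2π). The double Dirichlet series ζ_D(s) := Σ_{m=1}^∞ Σ_{n=1}^∞ (m² + (n/(2ℓ))²)^{−s} converges absolutely for Re(s) > 1, and there exist ε > 0 and a holomorphic function F on {s ∈ ℂ : Re(s) > −ε} \ {1/2, 1} that agrees with ζ_D(s) on {Re(s) > 1}. Moreover the zeta-regularized determinant exp(−F′(0)) equals (1/√(2π)) · δ^{1/12} · ∏_{n=1}^∞ (1 − δ^{2n}). -/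
open Complex HurwitzZeta Filter Topology Asymptotics Set MeasureTheory
open scoped Real

namespace HalfAnnulus

/-- The heat trace `∑_{n ≥ 1} exp (-n² t)` of the Dirichlet Laplacian on `[0, π]`. -/
noncomputable def heatTrace (t : ℝ) : ℝ := (cosKernel 0 (t / π) - 1) / 2

lemma hasSum_heatTrace {t : ℝ} (ht : 0 < t) :
    HasSum (fun n : ℕ ↦ rexp (-((n : ℝ) + 1) ^ 2 * t)) (heatTrace t) := by
  have h := (hasSum_nat_cosKernel₀ 0 (div_pos ht Real.pi_pos)).div_const 2
  rw [QuotientAddGroup.mk_zero] at h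
  refine h.congr_fun fun n ↦ ?_
  simp only [mul_zero, zero_mul, Real.cos_zero]
  have : -π * ((n : ℝ) + 1) ^ 2 * (t / π) = -((n : ℝ) + 1) ^ 2 * t := by
    field_simp
  rw [this]
  ring

lemma heatTrace_nonneg {t : ℝ} (ht : 0 < t) : 0 ≤ heatTrace t :=
  (hasSum_heatTrace ht).nonneg fun _ ↦ (Real.exp_pos _).le

lemma continuousOn_heatTrace : ContinuousOn heatTrace (Ioi 0) := by
  refine ContinuousOn.div_const (ContinuousOn.sub ?_ continuousOn_const) _
  refine (continuousOn_cosKernel 0).comp (by fun_prop) fun t ht ↦ ?_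
  exact div_pos ht Real.pi_pos

lemma heatTrace_mul {c t : ℝ} (hc : 0 < c) (ht : 0 < t) :
    heatTrace (c ^ 2 * t) =
      -1 / 2 + √π / c * t ^ (-1 / 2 : ℝ) * (1 / 2 + heatTrace (π ^ 2 / c ^ 2 * t⁻¹)) := by
  have hpi := Real.pi_pos
  have hx : 1 / (c ^ 2 * t / π) = π ^ 2 / c ^ 2 * t⁻¹ / π := by field_simp
  have hs : 1 / (c ^ 2 * t / π) ^ (1 / 2 : ℝ) = √π / c * t ^ (-1 / 2 : ℝ) := by
    rw [neg_div, Real.rpow_neg ht.le, ← Real.sqrt_eq_rpow, ← Real.sqrt_eq_rpow,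
      Real.sqrt_div (by positivity), Real.sqrt_mul (by positivity), Real.sqrt_sq hc.le]
    field_simp
  rw [heatTrace, heatTrace, ← hx, ← hs, ← evenKernel_eq_cosKernel_of_zero,
    evenKernel_functional_equation, evenKernel_eq_cosKernel_of_zero]
  ring

lemma exp_neg_le_rpow {p x : ℝ} (hp : 0 < p) (hx : 0 < x) :
    rexp (-x) ≤ p ^ p * x ^ (-p) := by
  have h : x / p ≤ rexp (x / p) := by linarith [Real.add_one_le_exp (x / p)]
  have h2 := Real.rpow_le_rpow (by positivity) h hp.le
  rw [← Real.exp_mul, div_mul_cancel₀ _ hp.ne', Real.div_rpow hx.le hp.le] at h2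
  rw [Real.exp_neg, Real.rpow_neg hx.le, ← div_eq_mul_inv,
    inv_le_comm₀ (Real.exp_pos x) (by positivity), inv_div]
  exact h2

lemma exists_heatTrace_le {p : ℝ} (hp : 1 / 2 < p) :
    ∃ C : ℝ, 0 ≤ C ∧ ∀ t : ℝ, 0 < t → heatTrace t ≤ C * t ^ (-p) := by
  have hp0 : 0 < p := by linarith
  have hsum : Summable fun n : ℕ ↦ ((n : ℝ) + 1) ^ (-(2 * p)) := by
    have := (summable_nat_add_iff 1).mpr
      (Real.summable_nat_rpow.mpr (show -(2 * p) < -1 by linarith))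
    simpa using this
  refine ⟨p ^ p * ∑' n : ℕ, ((n : ℝ) + 1) ^ (-(2 * p)),
    mul_nonneg (by positivity) (tsum_nonneg fun n ↦ by positivity), fun t ht ↦ ?_⟩
  refine hasSum_le (fun n ↦ ?_) (hasSum_heatTrace ht)
    ((hsum.hasSum.mul_left (p ^ p)).mul_right (t ^ (-p)))
  have hn : (0 : ℝ) < (n : ℝ) + 1 := by positivity
  have h := exp_neg_le_rpow hp0 (show 0 < ((n : ℝ) + 1) ^ 2 * t by positivity)
  have hpow : (((n : ℝ) + 1) ^ 2) ^ (-p) = ((n : ℝ) + 1) ^ (-(2 * p)) := by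
    rw [← Real.rpow_two, ← Real.rpow_mul hn.le, mul_neg]
  rwa [Real.mul_rpow (by positivity) ht.le, hpow, ← mul_assoc, ← neg_mul] at h

/-- The off-diagonal part of the product of heat traces after Poisson summation. -/
noncomputable def crossTrace (c t : ℝ) : ℝ := heatTrace t * heatTrace (π ^ 2 / c ^ 2 * t⁻¹)

lemma exists_abs_crossTrace_le {c : ℝ} (hc : 0 < c) (a : ℝ) :
    ∃ C : ℝ, ∀ t : ℝ, 0 < t → |crossTrace c t| ≤ C * t ^ (-a) := by
  obtain ⟨C, hC, h⟩ := exists_heatTrace_le (p := 1 + |a|) (by linarith [abs_nonneg a])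
  obtain ⟨D, hD, h'⟩ := exists_heatTrace_le (p := 1 + |a| - a) (by linarith [le_abs_self a])
  have hd : 0 < π ^ 2 / c ^ 2 := by positivity
  refine ⟨C * (D * (π ^ 2 / c ^ 2) ^ (-(1 + |a| - a))), fun t ht ↦ ?_⟩
  have hdt : 0 < π ^ 2 / c ^ 2 * t⁻¹ := by positivity
  rw [crossTrace, abs_of_nonneg (mul_nonneg (heatTrace_nonneg ht) (heatTrace_nonneg hdt))]
  refine (mul_le_mul (h t ht) (h' _ hdt) (heatTrace_nonneg hdt) (by positivity)).trans_eq ?_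
  rw [Real.mul_rpow hd.le (by positivity), Real.inv_rpow ht.le, ← Real.rpow_neg ht.le]
  have : t ^ (-a) = t ^ (-(1 + |a|)) * t ^ (- -(1 + |a| - a)) := by
    rw [← Real.rpow_add ht]; ring_nf
  rw [this]
  ring

lemma continuousOn_crossTrace {c : ℝ} (hc : 0 < c) : ContinuousOn (crossTrace c) (Ioi 0) := by
  refine continuousOn_heatTrace.mul (continuousOn_heatTrace.comp ?_ fun t (ht : 0 < t) ↦ ?_)
  · exact continuousOn_const.mul (continuousOn_inv₀.mono fun t ht ↦ (ne_of_gt ht))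
  · exact Set.mem_Ioi.mpr (by positivity)

lemma locallyIntegrableOn_ofReal {f : ℝ → ℝ} (hf : ContinuousOn f (Ioi 0)) :
    LocallyIntegrableOn (fun t ↦ (f t : ℂ)) (Ioi 0) :=
  (continuous_ofReal.comp_continuousOn hf).locallyIntegrableOn measurableSet_Ioi

lemma isBigO_ofReal {f : ℝ → ℝ} {a C : ℝ} {l : Filter ℝ} (hl : ∀ᶠ t in l, 0 < t)
    (hf : ∀ t : ℝ, 0 < t → |f t| ≤ C * t ^ (-a)) :
    (fun t ↦ (f t : ℂ)) =O[l] (· ^ (-a)) := by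
  refine IsBigO.of_bound C ?_
  filter_upwards [hl] with t ht
  rw [norm_real, Real.norm_eq_abs, Real.norm_of_nonneg (by positivity)]
  exact hf t ht

lemma isBigO_crossTrace {c : ℝ} (hc : 0 < c) (a : ℝ) {l : Filter ℝ} (hl : ∀ᶠ t in l, 0 < t) :
    (fun t ↦ (crossTrace c t : ℂ)) =O[l] (· ^ (-a)) := by
  obtain ⟨C, hC⟩ := exists_abs_crossTrace_le hc a
  exact isBigO_ofReal hl hC

lemma mellinConvergent_crossTrace {c : ℝ} (hc : 0 < c) (s : ℂ) :
    MellinConvergent (fun t ↦ (crossTrace c t : ℂ)) s :=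
  mellinConvergent_of_isBigO_rpow (locallyIntegrableOn_ofReal (continuousOn_crossTrace hc))
    (isBigO_crossTrace hc (s.re + 1) (eventually_gt_atTop 0)) (by linarith)
    (isBigO_crossTrace hc (s.re - 1) eventually_mem_nhdsWithin) (by linarith)

lemma differentiable_mellin_crossTrace {c : ℝ} (hc : 0 < c) :
    Differentiable ℂ (mellin fun t ↦ (crossTrace c t : ℂ)) := fun s ↦
  mellin_differentiableAt_of_isBigO_rpow (locallyIntegrableOn_ofReal (continuousOn_crossTrace hc))
    (isBigO_crossTrace hc (s.re + 1) (eventually_gt_atTop 0)) (by linarith)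
    (isBigO_crossTrace hc (s.re - 1) eventually_mem_nhdsWithin) (by linarith)

lemma mellinConvergent_heatTrace {s : ℂ} (hs : 1 / 2 < s.re) :
    MellinConvergent (fun t ↦ (heatTrace t : ℂ)) s := by
  obtain ⟨C, -, hC⟩ := exists_heatTrace_le (p := s.re + 1) (by linarith)
  obtain ⟨D, -, hD⟩ := exists_heatTrace_le (p := (s.re + 1 / 2) / 2) (by linarith)
  refine mellinConvergent_of_isBigO_rpow (locallyIntegrableOn_ofReal continuousOn_heatTrace)
    (isBigO_ofReal (C := C) (eventually_gt_atTop 0) fun t ht ↦ ?_) (lt_add_one s.re)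
    (isBigO_ofReal (C := D) eventually_mem_nhdsWithin fun t ht ↦ ?_)
    (show (s.re + 1 / 2) / 2 < s.re by linarith)
  · exact (abs_of_nonneg (heatTrace_nonneg ht)).trans_le (hC t ht)
  · exact (abs_of_nonneg (heatTrace_nonneg ht)).trans_le (hD t ht)

lemma mellin_heatTrace {s : ℂ} (hs : 1 / 2 < s.re) :
    mellin (fun t ↦ (heatTrace t : ℂ)) s = Gamma s * riemannZeta (2 * s) := by
  have hsum : Summable fun n : ℕ ↦ ‖(1 : ℂ)‖ / (((n : ℝ) + 1) ^ 2) ^ s.re := by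
    have := (summable_nat_add_iff 1).mpr
      (Real.summable_nat_rpow.mpr (show -(2 * s.re) < -1 by linarith))
    refine this.congr fun n ↦ ?_
    have hn : (0 : ℝ) ≤ (n : ℝ) + 1 := by positivity
    push_cast
    rw [norm_one, Real.rpow_neg hn, Real.rpow_mul hn, one_div, Real.rpow_two]
  have h := hasSum_mellin (a := fun _ : ℕ ↦ 1) (p := fun n : ℕ ↦ ((n : ℝ) + 1) ^ 2)
    (F := fun t ↦ (heatTrace t : ℂ)) (fun n ↦ Or.inr (by positivity))
    (show 0 < s.re by linarith) (fun t ht ↦ ?_) hsum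
  · rw [← h.tsum_eq, zeta_eq_tsum_one_div_nat_add_one_cpow (by simp; linarith), ← tsum_mul_left]
    refine tsum_congr fun n ↦ ?_
    have hn : (0 : ℝ) ≤ (n : ℝ) + 1 := by positivity
    have : (((((n : ℝ) + 1) ^ 2 : ℝ) : ℂ)) ^ s = ((n : ℂ) + 1) ^ (2 * s) := by
      rw [sq, ofReal_mul, mul_cpow_ofReal_nonneg hn hn, two_mul,
        cpow_add _ _ (Nat.cast_add_one_ne_zero n)]
      push_cast
      rfl
    rw [this]
    ring
  · simpa using (hasSum_ofReal.mpr (hasSum_heatTrace ht))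

/-- The primitive of the Gaussian vanishing at `0`. -/
noncomputable def gaussPrimitive (x : ℝ) : ℝ := ∫ y in (0 : ℝ)..x, rexp (-y ^ 2)

lemma hasDerivAt_gaussPrimitive (x : ℝ) : HasDerivAt gaussPrimitive (rexp (-x ^ 2)) x :=
  intervalIntegral.integral_hasDerivAt_right (Continuous.intervalIntegrable (by fun_prop) _ _)
    (Continuous.stronglyMeasurableAtFilter (by fun_prop) _ _) (by fun_prop)

lemma tendsto_gaussPrimitive_atTop : Tendsto gaussPrimitive atTop (𝓝 (√π / 2)) := by
  have hint : Integrable fun y : ℝ ↦ rexp (-y ^ 2) := by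
    simpa using integrable_exp_neg_mul_sq one_pos
  have h := intervalIntegral_tendsto_integral_Ioi 0 hint.integrableOn tendsto_id
  have h2 := integral_gaussian_Ioi 1
  simp only [neg_mul, one_mul, div_one] at h2
  rwa [h2] at h

lemma gaussPrimitive_neg (x : ℝ) : gaussPrimitive (-x) = -gaussPrimitive x := by
  have h := intervalIntegral.integral_comp_neg (a := 0) (b := x) fun y : ℝ ↦ rexp (-y ^ 2)
  simp only [neg_sq, neg_zero] at h
  rw [gaussPrimitive, intervalIntegral.integral_symm, ← h, gaussPrimitive]

lemma tendsto_gaussPrimitive_atBot : Tendsto gaussPrimitive atBot (𝓝 (-(√π / 2))) := by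
  refine (tendsto_gaussPrimitive_atTop.comp tendsto_neg_atBot_atTop).neg.congr fun x ↦ ?_
  simp [gaussPrimitive_neg]

lemma integrableOn_and_integral_exp_neg_add_inv {m b : ℝ} (hm : 0 < m) (hb : 0 < b) :
    IntegrableOn (fun t : ℝ ↦ t ^ (-3 / 2 : ℝ) * rexp (-(m ^ 2 * t + b ^ 2 * t⁻¹))) (Ioi 0) ∧
    ∫ t in Ioi (0 : ℝ), t ^ (-3 / 2 : ℝ) * rexp (-(m ^ 2 * t + b ^ 2 * t⁻¹)) =
      √π / b * rexp (-(2 * m * b)) := by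
  set G : ℝ → ℝ := fun t ↦ (rexp (-(2 * m * b)) * gaussPrimitive (m * √t - b * (√t)⁻¹) -
    rexp (2 * m * b) * gaussPrimitive (m * √t + b * (√t)⁻¹)) / b
  set L₀ : ℝ := (rexp (-(2 * m * b)) * -(√π / 2) - rexp (2 * m * b) * (√π / 2)) / b with hL₀
  have hsqrt0 : Tendsto (fun t : ℝ ↦ √t) (𝓝[>] 0) (𝓝[>] 0) := by
    refine tendsto_nhdsWithin_iff.mpr ⟨?_, ?_⟩
    · have := Real.continuous_sqrt.tendsto 0
      rw [Real.sqrt_zero] at this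
      exact this.mono_left nhdsWithin_le_nhds
    · filter_upwards [self_mem_nhdsWithin] with t ht using Real.sqrt_pos.mpr ht
  have hinv0 : Tendsto (fun t : ℝ ↦ b * (√t)⁻¹) (𝓝[>] 0) atTop :=
    (tendsto_inv_nhdsGT_zero.comp hsqrt0).const_mul_atTop hb
  have hlin0 : Tendsto (fun t : ℝ ↦ m * √t) (𝓝[>] 0) (𝓝 (m * 0)) :=
    (hsqrt0.mono_right nhdsWithin_le_nhds).const_mul m
  have hinvT : Tendsto (fun t : ℝ ↦ b * (√t)⁻¹) atTop (𝓝 (b * 0)) :=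
    (tendsto_inv_atTop_zero.comp Real.tendsto_sqrt_atTop).const_mul b
  have hlinT : Tendsto (fun t : ℝ ↦ m * √t) atTop atTop :=
    Real.tendsto_sqrt_atTop.const_mul_atTop hm
  have h0 : Tendsto G (𝓝[>] 0) (𝓝 L₀) := by
    refine (Tendsto.sub (Tendsto.const_mul _ (tendsto_gaussPrimitive_atBot.comp ?_))
      (Tendsto.const_mul _ (tendsto_gaussPrimitive_atTop.comp ?_))).div_const b
    · simpa only [sub_eq_add_neg, Function.comp_def] using hlin0.add_atBot (tendsto_neg_atTop_atBot.comp hinv0)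
    · exact hlin0.add_atTop hinv0
  have hT : Tendsto G atTop
      (𝓝 ((rexp (-(2 * m * b)) * (√π / 2) - rexp (2 * m * b) * (√π / 2)) / b)) := by
    refine (Tendsto.sub (Tendsto.const_mul _ (tendsto_gaussPrimitive_atTop.comp ?_))
      (Tendsto.const_mul _ (tendsto_gaussPrimitive_atTop.comp ?_))).div_const b
    · simpa only [sub_eq_add_neg] using hlinT.atTop_add hinvT.neg
    · exact hlinT.atTop_add hinvT
  have hderiv : ∀ t ∈ Ioi (0 : ℝ), HasDerivAt (Function.update G 0 L₀)
      (t ^ (-3 / 2 : ℝ) * rexp (-(m ^ 2 * t + b ^ 2 * t⁻¹))) t := by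
    intro t (ht : 0 < t)
    have hst : 0 < √t := Real.sqrt_pos.mpr ht
    have hs := (Real.hasDerivAt_sqrt ht.ne')
    have hi := (hs.inv hst.ne').const_mul b
    have hl := hs.const_mul m
    have h1 := ((hasDerivAt_gaussPrimitive _).comp t (hl.sub hi)).const_mul (rexp (-(2 * m * b)))
    have h2 := ((hasDerivAt_gaussPrimitive _).comp t (hl.add hi)).const_mul (rexp (2 * m * b))
    have h3 := (h1.sub h2).div_const b
    have hcongr : Function.update G 0 L₀ =ᶠ[𝓝 t] G := by
      filter_upwards [eventually_ne_nhds ht.ne'] with x hx using Function.update_of_ne hx _ _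
    refine HasDerivAt.congr_of_eventuallyEq ?_ hcongr
    refine h3.congr_deriv ?_
    have hpow : t ^ (-3 / 2 : ℝ) = (√t ^ 3)⁻¹ := by
      rw [Real.sqrt_eq_rpow, ← Real.rpow_natCast, ← Real.rpow_mul ht.le, ← Real.rpow_neg ht.le]
      norm_num
    have e1 : rexp (-(2 * m * b)) * rexp (-(m * √t - b * (√t)⁻¹) ^ 2) =
        rexp (-(m ^ 2 * t + b ^ 2 * t⁻¹)) := by
      rw [← Real.exp_add, show m ^ 2 * t + b ^ 2 * t⁻¹ = m ^ 2 * √t ^ 2 + b ^ 2 * (√t ^ 2)⁻¹ by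
        rw [Real.sq_sqrt ht.le]]
      congr 1
      field_simp
      ring
    have e2 : rexp (2 * m * b) * rexp (-(m * √t + b * (√t)⁻¹) ^ 2) =
        rexp (-(m ^ 2 * t + b ^ 2 * t⁻¹)) := by
      rw [← Real.exp_add, show m ^ 2 * t + b ^ 2 * t⁻¹ = m ^ 2 * √t ^ 2 + b ^ 2 * (√t ^ 2)⁻¹ by
        rw [Real.sq_sqrt ht.le]]
      congr 1
      field_simp
      ring
    simp only [Pi.sub_apply, Pi.add_apply, Pi.inv_apply]
    rw [← mul_assoc, ← mul_assoc, e1, e2, hpow]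
    field_simp
    ring
  have hcont : ContinuousWithinAt (Function.update G 0 L₀) (Ici 0) 0 := by
    rw [continuousWithinAt_update_same, Ici_sdiff_left]
    exact h0
  have hT' : Tendsto (Function.update G 0 L₀) atTop
      (𝓝 ((rexp (-(2 * m * b)) * (√π / 2) - rexp (2 * m * b) * (√π / 2)) / b)) := by
    refine hT.congr' ?_
    filter_upwards [eventually_ne_atTop 0] with x hx using (Function.update_of_ne hx _ _).symm
  have hpos : ∀ t ∈ Ioi (0 : ℝ),
      0 ≤ t ^ (-3 / 2 : ℝ) * rexp (-(m ^ 2 * t + b ^ 2 * t⁻¹)) := fun t (ht : 0 < t) ↦ by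
    positivity
  refine ⟨integrableOn_Ioi_deriv_of_nonneg hcont hderiv hpos hT', ?_⟩
  rw [integral_Ioi_of_hasDerivAt_of_nonneg hcont hderiv hpos hT', Function.update_self, hL₀]
  ring

lemma hasSum_heatTrace_mul {t u : ℝ} (ht : 0 < t) (hu : 0 < u) :
    HasSum (fun p : ℕ × ℕ ↦ rexp (-(((p.1 : ℝ) + 1) ^ 2 * t + ((p.2 : ℝ) + 1) ^ 2 * u)))
      (heatTrace t * heatTrace u) := by
  have h1 := hasSum_heatTrace ht
  have h2 := hasSum_heatTrace hu
  refine (h1.mul h2 (h1.summable.mul_of_nonneg h2.summable (fun _ ↦ (Real.exp_pos _).le)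
    fun _ ↦ (Real.exp_pos _).le)).congr_fun fun p ↦ ?_
  rw [← Real.exp_add]
  ring_nf

lemma tprod_one_sub_pow_pos_and_hasSum {δ : ℝ} (h0 : 0 < δ) (h1 : δ < 1) :
    0 < ∏' n : ℕ, (1 - δ ^ (2 * (n + 1))) ∧
    HasSum (fun p : ℕ × ℕ ↦ (δ ^ (2 * (p.1 + 1))) ^ (p.2 + 1) / ((p.2 : ℝ) + 1))
      (-Real.log (∏' n : ℕ, (1 - δ ^ (2 * (n + 1))))) := by
  have hlt (n : ℕ) : δ ^ (2 * (n + 1)) < 1 := pow_lt_one₀ h0.le h1 (by lia)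
  have hsum : Summable fun n : ℕ ↦ -δ ^ (2 * (n + 1)) := by
    have := (summable_nat_add_iff 1).mpr
      (summable_geometric_of_lt_one (by positivity) (pow_lt_one₀ h0.le h1 two_ne_zero))
    simpa only [pow_mul] using this.neg
  have hlog : Summable fun n : ℕ ↦ Real.log (1 - δ ^ (2 * (n + 1))) := by
    simpa only [sub_eq_add_neg] using Real.summable_log_one_add_of_summable hsum
  have hprod := Real.rexp_tsum_eq_tprod (fun n ↦ sub_pos.mpr (hlt n)) hlog
  have hfib (n : ℕ) : HasSum (fun k : ℕ ↦ (δ ^ (2 * (n + 1))) ^ (k + 1) / ((k : ℝ) + 1))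
      (-Real.log (1 - δ ^ (2 * (n + 1)))) :=
    Real.hasSum_pow_div_log_of_abs_lt_one (by rw [abs_of_pos (by positivity)]; exact hlt n)
  rw [← hprod, Real.log_exp, ← tsum_neg]
  refine ⟨Real.exp_pos _, ?_⟩
  have hs : Summable fun p : ℕ × ℕ ↦
      (δ ^ (2 * (p.1 + 1))) ^ (p.2 + 1) / ((p.2 : ℝ) + 1) := by
    rw [summable_prod_of_nonneg fun p ↦ by positivity]
    exact ⟨fun n ↦ (hfib n).summable, hlog.neg.congr fun n ↦ (hfib n).tsum_eq.symm⟩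
  rw [(hs.hasSum.prod_fiberwise hfib).tsum_eq]
  exact hs.hasSum

lemma mellin_crossTrace_neg_half {c δ : ℝ} (hc : 0 < c) (h0 : 0 < δ) (h1 : δ < 1)
    (hδ : δ = rexp (-(π / c))) :
    (√π / c : ℂ) * mellin (fun t ↦ (crossTrace c t : ℂ)) (-1 / 2) =
      (-Real.log (∏' n : ℕ, (1 - δ ^ (2 * (n + 1)))) : ℝ) := by
  have hpi := Real.pi_pos
  set f : ℕ × ℕ → ℝ → ℝ := fun p t ↦ t ^ (-3 / 2 : ℝ) *
    rexp (-(((p.1 : ℝ) + 1) ^ 2 * t + (π / c * ((p.2 : ℝ) + 1)) ^ 2 * t⁻¹)) with hf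
  have hI (p : ℕ × ℕ) := integrableOn_and_integral_exp_neg_add_inv
    (m := (p.1 : ℝ) + 1) (b := π / c * ((p.2 : ℝ) + 1)) (by positivity) (by positivity)
  have hfsum : ∀ t ∈ Ioi (0 : ℝ), ∑' p, f p t = t ^ (-3 / 2 : ℝ) * crossTrace c t := by
    intro t (ht : 0 < t)
    have := (hasSum_heatTrace_mul ht (u := π ^ 2 / c ^ 2 * t⁻¹) (by positivity)).mul_left
      (t ^ (-3 / 2 : ℝ))
    rw [crossTrace, ← this.tsum_eq]
    refine tsum_congr fun p ↦ ?_
    simp only [hf]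
    congr 3
    ring
  have hval (p : ℕ × ℕ) : ∫ t in Ioi (0 : ℝ), f p t =
      c / √π * ((δ ^ (2 * (p.1 + 1))) ^ (p.2 + 1) / ((p.2 : ℝ) + 1)) := by
    rw [(hI p).2, hδ, ← pow_mul, ← Real.exp_nat_mul]
    have : -(2 * ((p.1 : ℝ) + 1) * (π / c * ((p.2 : ℝ) + 1))) =
        ((2 * (p.1 + 1) * (p.2 + 1) : ℕ) : ℝ) * -(π / c) := by push_cast; ring
    rw [this]
    have h2 : √π * √π = π := Real.mul_self_sqrt hpi.le
    field_simp
    rw [sq, h2]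
  have hS := (tprod_one_sub_pow_pos_and_hasSum h0 h1).2.mul_left (c / √π)
  have key : HasSum (fun p ↦ ∫ t in Ioi (0 : ℝ), f p t)
      (∫ t in Ioi (0 : ℝ), ∑' p, f p t) := by
    refine hasSum_integral_of_summable_integral_norm (fun p ↦ (hI p).1) ?_
    refine hS.summable.congr fun p ↦ ?_
    rw [← hval p]
    refine setIntegral_congr_fun measurableSet_Ioi fun t (ht : 0 < t) ↦ ?_
    exact (Real.norm_of_nonneg (by positivity)).symm
  have hm : mellin (fun t ↦ (crossTrace c t : ℂ)) (-1 / 2) =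
      ((∫ t in Ioi (0 : ℝ), ∑' p, f p t : ℝ) : ℂ) := by
    rw [mellin, ← integral_complex_ofReal]
    refine setIntegral_congr_fun measurableSet_Ioi fun t (ht : 0 < t) ↦ ?_
    simp only [smul_eq_mul]
    rw [hfsum t ht, ofReal_mul, ofReal_cpow ht.le]
    norm_num
  simp_rw [hval] at key
  rw [hm, key.unique hS]
  have : (√π : ℂ) ≠ 0 := by exact_mod_cast (Real.sqrt_pos.mpr hpi).ne'
  have : (c : ℂ) ≠ 0 := by exact_mod_cast hc.ne'
  push_cast
  field_simp

lemma mellin_heatTrace_mul {c : ℝ} (hc : 0 < c) {s : ℂ} (hs : 1 < s.re) :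
    mellin (fun t ↦ ((heatTrace t * heatTrace (c ^ 2 * t) : ℝ) : ℂ)) s =
      -1 / 2 * (Gamma s * riemannZeta (2 * s)) +
        √π / c * (1 / 2 * (Gamma (s - 1 / 2) * riemannZeta (2 * s - 1)) +
          mellin (fun t ↦ (crossTrace c t : ℂ)) (s - 1 / 2)) := by
  have hre : 1 / 2 < (s - 1 / 2).re := by
    have : (1 / 2 : ℂ).re = 1 / 2 := by norm_num
    rw [sub_re, this]
    linarith
  have c1 : MellinConvergent (fun t ↦ (heatTrace t : ℂ)) s :=
    mellinConvergent_heatTrace (by linarith)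
  have c2 := mellinConvergent_heatTrace hre
  have c3 := mellinConvergent_crossTrace hc (s - 1 / 2)
  rw [sub_eq_add_neg, ← MellinConvergent.cpow_smul] at c2 c3
  have e2 := mellin_heatTrace hre
  have e1 := mellin_heatTrace (s := s) (by linarith)
  rw [show 2 * (s - 1 / 2) = 2 * s - 1 by ring] at e2
  rw [← e1, ← e2, sub_eq_add_neg, ← mellin_cpow_smul, ← mellin_cpow_smul]
  simp only [mellin, MellinConvergent] at c1 c2 c3 ⊢
  have c4 : IntegrableOn (fun t : ℝ ↦ (√π / c : ℂ) *
      (1 / 2 * (t : ℂ) ^ (s - 1) • (t : ℂ) ^ (-(1 / 2) : ℂ) • (heatTrace t : ℂ) +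
        (t : ℂ) ^ (s - 1) • (t : ℂ) ^ (-(1 / 2) : ℂ) • (crossTrace c t : ℂ))) (Ioi 0) :=
    ((c2.const_mul _).add c3).const_mul _
  rw [← integral_const_mul, ← integral_const_mul, ← integral_add (c2.const_mul _) c3,
    ← integral_const_mul, ← integral_add (c1.const_mul _) c4]
  refine setIntegral_congr_fun measurableSet_Ioi fun t (ht : 0 < t) ↦ ?_
  have hp : (((t ^ (-1 / 2 : ℝ) : ℝ)) : ℂ) = (t : ℂ) ^ (-(1 / 2) : ℂ) := by
    rw [ofReal_cpow ht.le]
    norm_num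
  simp only [smul_eq_mul, crossTrace]
  rw [heatTrace_mul hc ht, ← hp]
  push_cast
  ring

lemma summable_eigenvalue_rpow {c σ : ℝ} (hc : 0 < c) (hσ : 1 < σ) :
    Summable fun p : ℕ × ℕ ↦ (((p.1 : ℝ) + 1) ^ 2 + (((p.2 : ℝ) + 1) * c) ^ 2) ^ (-σ) := by
  have h : Summable fun n : ℕ ↦ ((n : ℝ) + 1) ^ (-σ) := by
    simpa using (summable_nat_add_iff 1).mpr (Real.summable_nat_rpow.mpr (neg_lt_neg hσ))
  have h2 := (h.mul_of_nonneg h (fun n ↦ by positivity) fun n ↦ by positivity).mul_left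
    ((2 * c) ^ (-σ))
  refine h2.of_nonneg_of_le (fun p ↦ by positivity) fun p ↦ ?_
  rw [← Real.mul_rpow (by positivity) (by positivity),
    ← Real.mul_rpow (by positivity) (by positivity)]
  refine Real.rpow_le_rpow_of_nonpos (by positivity) ?_ (by linarith)
  nlinarith [sq_nonneg ((p.1 : ℝ) + 1 - ((p.2 : ℝ) + 1) * c)]

lemma mellin_heatTrace_mul_eq_tsum {c : ℝ} (hc : 0 < c) {s : ℂ} (hs : 1 < s.re) :
    mellin (fun t ↦ ((heatTrace t * heatTrace (c ^ 2 * t) : ℝ) : ℂ)) s =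
      Gamma s * ∑' p : ℕ × ℕ,
        (((((p.1 : ℝ) + 1) ^ 2 + (((p.2 : ℝ) + 1) * c) ^ 2 : ℝ)) : ℂ) ^ (-s) := by
  have h := hasSum_mellin (a := fun _ : ℕ × ℕ ↦ 1)
    (p := fun p : ℕ × ℕ ↦ ((p.1 : ℝ) + 1) ^ 2 + (((p.2 : ℝ) + 1) * c) ^ 2)
    (F := fun t ↦ ((heatTrace t * heatTrace (c ^ 2 * t) : ℝ) : ℂ))
    (fun p ↦ Or.inr (by positivity)) (show 0 < s.re by linarith) (fun t (ht : 0 < t) ↦ ?_) ?_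
  · rw [← h.tsum_eq, ← tsum_mul_left]
    simp only [cpow_neg, mul_one, div_eq_mul_inv]
  · have := hasSum_ofReal.mpr (hasSum_heatTrace_mul ht (u := c ^ 2 * t) (by positivity))
    refine this.congr_fun fun p ↦ ?_
    rw [one_mul]
    congr 2
    ring
  · refine (summable_eigenvalue_rpow hc hs).congr fun p ↦ ?_
    rw [Real.rpow_neg (by positivity), norm_one, one_div]

/-- The analytic continuation of the spectral zeta function
`∑_{m, n ≥ 1} (m² + c² n²)^(-s)`. -/
noncomputable def spectralZeta (c : ℝ) (s : ℂ) : ℂ :=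
  -1 / 2 * riemannZeta (2 * s) + (Gamma s)⁻¹ *
    (√π / c * (1 / 2 * (Gamma (s - 1 / 2) * riemannZeta (2 * s - 1)) +
      mellin (fun t ↦ (crossTrace c t : ℂ)) (s - 1 / 2)))

lemma spectralZeta_eq_tsum {c : ℝ} (hc : 0 < c) {s : ℂ} (hs : 1 < s.re) :
    spectralZeta c s = ∑' p : ℕ × ℕ,
      (((((p.1 : ℝ) + 1) ^ 2 + (((p.2 : ℝ) + 1) * c) ^ 2 : ℝ)) : ℂ) ^ (-s) := by
  have hG : Gamma s ≠ 0 := Gamma_ne_zero_of_re_pos (by linarith)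
  refine mul_left_cancel₀ hG ?_
  rw [← mellin_heatTrace_mul_eq_tsum hc hs, mellin_heatTrace_mul hc hs, spectralZeta]
  field_simp

lemma differentiableAt_regularPart {c : ℝ} (hc : 0 < c) {s : ℂ} (hs : -(1 / 2) < s.re)
    (h2 : s ≠ 1 / 2) (h1 : s ≠ 1) :
    DifferentiableAt ℂ (fun s : ℂ ↦
      √π / c * (1 / 2 * (Gamma (s - 1 / 2) * riemannZeta (2 * s - 1)) +
        mellin (fun t ↦ (crossTrace c t : ℂ)) (s - 1 / 2))) s := by
  have hG : DifferentiableAt ℂ (fun s : ℂ ↦ Gamma (s - 1 / 2)) s := by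
    refine DifferentiableAt.comp s (g := Gamma) (differentiableAt_Gamma _ fun n h ↦ ?_)
      (by fun_prop)
    rcases n with _ | n
    · exact h2 (by simpa [sub_eq_zero] using h)
    · have := congrArg re h
      simp at this
      have hn : (0 : ℝ) ≤ n := n.cast_nonneg
      linarith
  have hZ : DifferentiableAt ℂ (fun s : ℂ ↦ riemannZeta (2 * s - 1)) s := by
    refine DifferentiableAt.comp s (g := riemannZeta)
      (differentiableAt_riemannZeta fun h ↦ h1 ?_) (by fun_prop)
    linear_combination h / 2
  have hM : DifferentiableAt ℂ
      (fun s : ℂ ↦ mellin (fun t ↦ (crossTrace c t : ℂ)) (s - 1 / 2)) s :=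
    (differentiable_mellin_crossTrace hc _).comp s (by fun_prop)
  exact (((hG.mul hZ).const_mul _).add hM).const_mul _

lemma hasDerivAt_Gamma_inv_zero : HasDerivAt (fun s : ℂ ↦ (Gamma s)⁻¹) 1 0 := by
  have h : (fun s : ℂ ↦ (Gamma s)⁻¹) = fun s ↦ s * (Gamma (s + 1))⁻¹ :=
    funext one_div_Gamma_eq_self_mul_one_div_Gamma_add_one
  have hd : DifferentiableAt ℂ (fun s : ℂ ↦ (Gamma (s + 1))⁻¹) 0 :=
    (differentiable_one_div_Gamma _).comp 0 (by fun_prop)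
  rw [h]
  exact ((hasDerivAt_id (0 : ℂ)).mul hd.hasDerivAt).congr_deriv (by simp)

lemma differentiableAt_riemannZeta_two_mul {s : ℂ} (h2 : s ≠ 1 / 2) :
    DifferentiableAt ℂ (fun s : ℂ ↦ riemannZeta (2 * s)) s := by
  refine DifferentiableAt.comp s (g := riemannZeta)
    (differentiableAt_riemannZeta fun h ↦ h2 ?_) (by fun_prop)
  linear_combination h / 2

lemma differentiableAt_spectralZeta {c : ℝ} (hc : 0 < c) {s : ℂ} (hs : -(1 / 2) < s.re)
    (h2 : s ≠ 1 / 2) (h1 : s ≠ 1) : DifferentiableAt ℂ (spectralZeta c) s :=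
  ((differentiableAt_riemannZeta_two_mul h2).const_mul _).add
    ((differentiable_one_div_Gamma s).mul (differentiableAt_regularPart hc hs h2 h1))

lemma deriv_spectralZeta_zero {c δ : ℝ} (hc : 0 < c) (h0 : 0 < δ) (h1 : δ < 1)
    (hδ : δ = rexp (-(π / c))) :
    deriv (spectralZeta c) 0 = ((Real.log (2 * π) / 2 - Real.log δ / 12 -
      Real.log (∏' n : ℕ, (1 - δ ^ (2 * (n + 1)))) : ℝ) : ℂ) := by
  have hpi := Real.pi_pos
  have hz : HasDerivAt (fun s : ℂ ↦ -1 / 2 * riemannZeta (2 * s))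
      (-1 / 2 * (deriv riemannZeta 0 * 2)) 0 := by
    have hd : HasDerivAt riemannZeta (deriv riemannZeta 0) (2 * 0) := by
      rw [mul_zero]
      exact (differentiableAt_riemannZeta (by norm_num)).hasDerivAt
    have hl : HasDerivAt (fun s : ℂ ↦ 2 * s) 2 0 := by
      simpa using (hasDerivAt_id (0 : ℂ)).const_mul 2
    exact (hd.comp 0 hl).const_mul _
  have hK := (differentiableAt_regularPart hc (s := 0) (by simp) (by norm_num)
    (by norm_num)).hasDerivAt
  have h := hz.add (hasDerivAt_Gamma_inv_zero.mul hK)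
  have hm := mellin_crossTrace_neg_half hc h0 h1 hδ
  have hG : Gamma (0 - 1 / 2) = -2 * √π := by
    have := Gamma_add_one (-1 / 2) (by norm_num)
    rw [show (-1 / 2 + 1 : ℂ) = 1 / 2 by norm_num, Gamma_one_half_eq] at this
    rw [show (0 - 1 / 2 : ℂ) = -1 / 2 by norm_num, Real.sqrt_eq_rpow, ofReal_cpow hpi.le]
    push_cast
    rw [this]
    ring
  have hZ : riemannZeta (2 * 0 - 1) = -1 / 12 := by
    have := riemannZeta_neg_nat_eq_bernoulli 1
    norm_num at this ⊢
    rw [this]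
  have hlogδ : Real.log δ = -(π / c) := by rw [hδ, Real.log_exp]
  have hlog : Complex.log (2 * π) = (Real.log (2 * π) : ℝ) := by
    rw [ofReal_log (by positivity)]
    push_cast
    rfl
  have hsq : (√π : ℂ) * √π = π := by exact_mod_cast Real.mul_self_sqrt hpi.le
  rw [show spectralZeta c = _ from rfl]
  refine h.deriv.trans ?_
  rw [hG, hZ, Gamma_zero, inv_zero, zero_mul, add_zero, one_mul, mul_add,
    show (0 - 1 / 2 : ℂ) = -1 / 2 by norm_num, hm, deriv_riemannZeta_zero, hlog, hlogδ]
  push_cast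
  linear_combination (1 / 12 / c : ℂ) * hsq

end HalfAnnulus

/-- Determinant of the Dirichlet Laplacian on the half-annulus `𝔸_δ⁺`
(eigenvalues `m² + (n/(2ℓ))²`, `m ≥ 1`, `n ≥ 1`) via zeta regularization. -/
theorem det_halfAnnulus_dirichlet (δ : ℝ) (hδ : δ ∈ Set.Ioo (0:ℝ) 1) (ℓ : ℝ)
    (hℓ : ℓ = Real.log (1/δ) / (2 * Real.pi)) :
    (∀ s : ℂ, 1 < s.re →
      Summable (fun p : ℕ × ℕ =>
        ‖(((((p.1 : ℝ) + 1))^2 + (((p.2 : ℝ) + 1) / (2 * ℓ))^2 : ℝ) : ℂ) ^ (-s)‖)) ∧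
    ∃ ε : ℝ, 0 < ε ∧ ∃ F : ℂ → ℂ,
      DifferentiableOn ℂ F ({s : ℂ | -ε < s.re} \ {1/2, 1}) ∧
      (∀ s : ℂ, 1 < s.re →
        F s = ∑' p : ℕ × ℕ,
          (((((p.1 : ℝ) + 1))^2 + (((p.2 : ℝ) + 1) / (2 * ℓ))^2 : ℝ) : ℂ) ^ (-s)) ∧
      Complex.exp (-(deriv F 0)) =
        ((1 / Real.sqrt (2 * Real.pi) * δ ^ ((1:ℝ)/12) *
          ∏' n : ℕ, (1 - δ ^ (2 * (n + 1))) : ℝ) : ℂ) := by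
  obtain ⟨h0, h1⟩ := hδ
  have hpi := Real.pi_pos
  have hlog : Real.log δ < 0 := Real.log_neg h0 h1
  have hℓ' : 2 * ℓ = -Real.log δ / π := by
    rw [hℓ, one_div, Real.log_inv]
    field_simp
  have hℓ0 : 0 < 2 * ℓ := by
    rw [hℓ']
    exact div_pos (by linarith) hpi
  have hc : 0 < (2 * ℓ)⁻¹ := inv_pos.mpr hℓ0
  have hδc : δ = rexp (-(π / (2 * ℓ)⁻¹)) := by
    rw [hℓ', div_inv_eq_mul, mul_div_cancel₀ _ hpi.ne', neg_neg, Real.exp_log h0]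
  simp only [div_eq_mul_inv _ (2 * ℓ)]
  refine ⟨fun s hs ↦ ?_, 1 / 2, by norm_num, HalfAnnulus.spectralZeta (2 * ℓ)⁻¹,
    fun s hs ↦ ?_, fun s hs ↦ HalfAnnulus.spectralZeta_eq_tsum hc hs, ?_⟩
  · refine (HalfAnnulus.summable_eigenvalue_rpow hc hs).congr fun p ↦ ?_
    rw [norm_cpow_eq_rpow_re_of_pos (by positivity), neg_re]
  · obtain ⟨hs, hs'⟩ := hs
    simp only [mem_insert_iff, mem_singleton_iff, not_or] at hs'
    exact (HalfAnnulus.differentiableAt_spectralZeta hc hs hs'.1 hs'.2).differentiableWithinAt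
  · rw [HalfAnnulus.deriv_spectralZeta_zero hc h0 h1 hδc, ← ofReal_neg, ← ofReal_exp]
    congr 1
    have hP := (HalfAnnulus.tprod_one_sub_pow_pos_and_hasSum h0 h1).1
    rw [Real.sqrt_eq_rpow, one_div, ← Real.rpow_neg (by positivity),
      Real.rpow_def_of_pos (by positivity), Real.rpow_def_of_pos h0]
    nth_rewrite 2 [← Real.exp_log hP]
    rw [← Real.exp_add, ← Real.exp_add]
    ring_nf
end

section
/- Let δ ∈ (0,1) and set ℓ := log(1/δ)/(2π). Consider the two double Dirichlet series ζ_full(s) := Σ_{m∈ℤ} Σ_{n=1}^∞ (m² + (n/(2ℓ))²)^{−s} and ζ_half(s) := Σ_{m=0}^∞ Σ_{n=1}^∞ (m² + (n/(2ℓ))²)^{−s}, both absolutely convergent for Re(s) > 1. Then there exist ε > 0 and holomorphic functions F_full, F_half on {s ∈ ℂ : Re(s) > −ε} \ {1/2, 1} agreeing with the respective series on {Re(s) > 1}, and their derivatives at 0 satisfy F_full′(0) = 2 F_half′(0) + log(4πℓ); equivalently, the zeta-regularized determinants satisfy exp(−F_half′(0)) = √(4πℓ) · exp(−F_full′(0))^{1/2}.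 -/
open Complex Filter Topology Asymptotics Set HurwitzZeta in
/-- Exponential decay of the product of two rescaled theta functions minus its limit. -/
theorem theta_mul_theta_sub_one_isBigO {b c : ℝ} (hb : 0 < b) (hc : 0 < c) (r : ℝ) :
    (fun t : ℝ ↦ ((evenKernel 0 (b * t) * evenKernel 0 (c * t) : ℝ) : ℂ) - 1)
      =O[atTop] (fun t : ℝ ↦ t ^ r) := by
  obtain ⟨p, hp, hO⟩ := isBigO_atTop_evenKernel_sub 0
  simp only [if_true] at hO
  have key : ∀ {d : ℝ}, 0 < d → ∀ r : ℝ,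
      (fun t : ℝ ↦ evenKernel 0 (d * t) - 1) =O[atTop] (fun t : ℝ ↦ t ^ r) := by
    intro d hd r
    have h1 := hO.comp_tendsto (tendsto_id.const_mul_atTop hd)
    have h2 := (isLittleO_exp_neg_mul_rpow_atTop (mul_pos hp hd) r).isBigO
    refine IsBigO.trans ?_ h2
    refine h1.congr (fun _ ↦ rfl) (fun t ↦ ?_)
    simp only [Function.comp, id]
    congr 1
    ring
  have hone : (fun t : ℝ ↦ evenKernel 0 (c * t)) =O[atTop] (fun _ : ℝ ↦ (1 : ℝ)) := by
    have h3 := key hc 0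
    simp only [Real.rpow_zero] at h3
    simpa using h3.add (isBigO_refl (fun _ : ℝ ↦ (1 : ℝ)) atTop)
  have hmul : (fun t : ℝ ↦ evenKernel 0 (b * t) * evenKernel 0 (c * t) - 1)
      =O[atTop] (fun t : ℝ ↦ t ^ r) := by
    have h4 := (key hb r).mul hone
    simp only [mul_one] at h4
    refine (h4.add (key hc r)).congr (fun t ↦ ?_) (fun _ ↦ rfl)
    ring
  refine (isBigO_ofReal_left.mpr hmul).congr (fun t ↦ ?_) (fun _ ↦ rfl)
  push_cast
  ring

open Complex Filter Topology Set HurwitzZeta MeasureTheory in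
theorem locallyIntegrableOn_theta_mul_theta {b c : ℝ} (hb : 0 < b) (hc : 0 < c) :
    LocallyIntegrableOn
      (fun t : ℝ ↦ ((evenKernel 0 (b * t) * evenKernel 0 (c * t) : ℝ) : ℂ)) (Ioi 0) := by
  have key : ∀ {d : ℝ}, 0 < d → ContinuousOn (fun t : ℝ ↦ evenKernel 0 (d * t)) (Ioi 0) :=
    fun hd ↦ (continuousOn_evenKernel 0).comp (by fun_prop) (fun t ht ↦ mul_pos hd ht)
  exact (continuous_ofReal.comp_continuousOn ((key hb).mul (key hc))).locallyIntegrableOn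
    measurableSet_Ioi

open HurwitzZeta in
theorem evenKernel_zero_inv {x : ℝ} (hx : 0 < x) :
    evenKernel 0 x⁻¹ = x ^ (1 / 2 : ℝ) * evenKernel 0 x := by
  rw [evenKernel_functional_equation, evenKernel_eq_cosKernel_of_zero, Real.inv_rpow hx.le]
  simp

open Complex HurwitzZeta in
/-- The functional-equation pair attached to the theta series of the quadratic form
`m² + (a n)²`. -/
noncomputable def epsteinFEPair (a : ℝ) (ha : 0 < a) : WeakFEPair ℂ where
  f t := ((evenKernel 0 (1 * t) * evenKernel 0 (a ^ 2 * t) : ℝ) : ℂ)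
  g t := ((evenKernel 0 (1 * t) * evenKernel 0 ((a ^ 2)⁻¹ * t) : ℝ) : ℂ)
  k := 1
  ε := (a : ℂ)⁻¹
  f₀ := 1
  g₀ := 1
  hf_int := locallyIntegrableOn_theta_mul_theta one_pos (by positivity)
  hg_int := locallyIntegrableOn_theta_mul_theta one_pos (by positivity)
  hk := one_pos
  hε := inv_ne_zero (ofReal_ne_zero.mpr ha.ne')
  h_feq x hx := by
    have hx : 0 < x := hx
    have hy : 0 < (a ^ 2)⁻¹ * x := by positivity
    have e1 : a ^ 2 * (1 / x) = ((a ^ 2)⁻¹ * x)⁻¹ := by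
      rw [mul_inv, inv_inv, one_div]
    have e2 : ((a ^ 2)⁻¹ * x) ^ (1 / 2 : ℝ) = a⁻¹ * x ^ (1 / 2 : ℝ) := by
      rw [Real.mul_rpow (by positivity) hx.le, ← inv_pow, ← Real.sqrt_eq_rpow,
        Real.sqrt_sq (by positivity)]
    have e3 : x ^ (1 / 2 : ℝ) * x ^ (1 / 2 : ℝ) = x := by
      rw [← Real.rpow_add hx]; norm_num
    rw [e1, one_mul, one_mul, one_div x, evenKernel_zero_inv hx, evenKernel_zero_inv hy, e2,
      smul_eq_mul, ← ofReal_inv, ← ofReal_mul, ← ofReal_mul, Real.rpow_one]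
    congr 1
    linear_combination (a⁻¹ * evenKernel 0 x * evenKernel 0 ((a ^ 2)⁻¹ * x)) * e3
  hf_top := theta_mul_theta_sub_one_isBigO one_pos (by positivity)
  hg_top := theta_mul_theta_sub_one_isBigO one_pos (by positivity)

theorem sq_add_sq_pos_of_ne_zero {a : ℝ} (ha : 0 < a) {p : ℤ × ℤ} (hp : p ≠ 0) :
    0 < (p.1 : ℝ) ^ 2 + (a * p.2) ^ 2 := by
  obtain ⟨m, n⟩ := p
  by_cases hm : m = 0
  · have hn : n ≠ 0 := by rintro rfl; exact hp (by simp [hm])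
    have : (n : ℝ) ≠ 0 := by exact_mod_cast hn
    simp only
    positivity
  · have : (m : ℝ) ≠ 0 := by exact_mod_cast hm
    simp only
    positivity

/-- Convergence of the Epstein zeta series in the half-plane `1 < σ`. -/
theorem summable_sq_add_sq_rpow {a : ℝ} (ha : 0 < a) {σ : ℝ} (hσ : 1 < σ) :
    Summable (fun p : ℤ × ℤ ↦ ((p.1 : ℝ) ^ 2 + (a * p.2) ^ 2) ^ (-σ)) := by
  have h := EisensteinSeries.summable_one_div_norm_rpow (k := 2 * σ) (by linarith)
  rw [← (finTwoArrowEquiv ℤ).symm.summable_iff] at h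
  set c : ℝ := min 1 (a ^ 2) with hc
  have hc0 : 0 < c := lt_min one_pos (by positivity)
  refine Summable.of_nonneg_of_le (fun p ↦ by positivity) (fun p ↦ ?_) (h.mul_left (c ^ (-σ)))
  by_cases hp : p = 0
  · subst hp
    simp [Real.zero_rpow (show -σ ≠ 0 by linarith)]
    positivity
  have hq := sq_add_sq_pos_of_ne_zero ha hp
  obtain ⟨m, n⟩ := p
  set v : Fin 2 → ℤ := (finTwoArrowEquiv ℤ).symm (m, n) with hv
  have hv0 : 0 < ‖v‖ := by
    rw [norm_pos_iff, hv]
    intro h0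
    apply hp
    have h1 := congrFun h0 0
    have h2 := congrFun h0 1
    simp at h1 h2
    simp [h1, h2]
  have hle : c * ‖v‖ ^ 2 ≤ (m : ℝ) ^ 2 + (a * n) ^ 2 := by
    have hvn : ‖v‖ = max |(m : ℝ)| |(n : ℝ)| := by
      rw [EisensteinSeries.norm_eq_max_natAbs]
      simp [hv, Nat.cast_natAbs]
    rw [hvn]
    have c1 : c ≤ 1 := min_le_left _ _
    have c2 : c ≤ a ^ 2 := min_le_right _ _
    rcases max_choice |(m : ℝ)| |(n : ℝ)| with h | h <;> rw [h, sq_abs]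
    · nlinarith [sq_nonneg (m : ℝ), sq_nonneg (a * n)]
    · nlinarith [sq_nonneg (m : ℝ), sq_nonneg (n : ℝ)]
  calc ((m : ℝ) ^ 2 + (a * n) ^ 2) ^ (-σ) ≤ (c * ‖v‖ ^ 2) ^ (-σ) :=
        Real.rpow_le_rpow_of_nonpos (by positivity) hle (by linarith)
    _ = c ^ (-σ) * ‖v‖ ^ (-(2 * σ)) := by
        rw [Real.mul_rpow hc0.le (by positivity), ← Real.rpow_natCast, ← Real.rpow_mul hv0.le]
        norm_num

open Complex in
theorem norm_ofReal_cpow_neg {x : ℝ} (hx : 0 ≤ x) {s : ℂ} (hs : s.re ≠ 0) :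
    ‖(x : ℂ) ^ (-s)‖ = x ^ (-s.re) := by
  rw [norm_cpow_eq_rpow_re_of_nonneg hx (by simpa using hs), neg_re]

open Complex in
theorem summable_sq_add_sq_cpow {a : ℝ} (ha : 0 < a) {s : ℂ} (hs : 1 < s.re) :
    Summable (fun p : ℤ × ℤ ↦ (((p.1 : ℝ) ^ 2 + (a * p.2) ^ 2 : ℝ) : ℂ) ^ (-s)) := by
  refine Summable.of_norm ((summable_sq_add_sq_rpow ha hs).congr fun p ↦ ?_)
  rw [norm_ofReal_cpow_neg (by positivity) (by linarith)]

open Complex HurwitzZeta in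
theorem hasSum_theta_mul_theta {a : ℝ} (ha : 0 < a) {t : ℝ} (ht : 0 < t) :
    HasSum (fun p : ℤ × ℤ ↦ Real.exp (-Real.pi * ((p.1 : ℝ) ^ 2 + (a * p.2) ^ 2) * t))
      (evenKernel 0 (1 * t) * evenKernel 0 (a ^ 2 * t)) := by
  have h1 := hasSum_int_evenKernel 0 (t := 1 * t) (by positivity)
  have h2 := hasSum_int_evenKernel 0 (t := a ^ 2 * t) (by positivity)
  have h3 := h1.mul h2 (h1.summable.mul_of_nonneg h2.summable
    (fun _ ↦ (Real.exp_pos _).le) (fun _ ↦ (Real.exp_pos _).le))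
  convert! h3 using 2 with p
  rw [← Real.exp_add]
  congr 1
  ring

open Complex in
/-- The Epstein zeta series as a Mellin transform. -/
theorem epsteinFEPair_Λ_eq {a : ℝ} (ha : 0 < a) {s : ℂ} (hs : 1 < s.re) :
    (epsteinFEPair a ha).Λ s = Real.pi ^ (-s) * Gamma s *
      ∑' p : ℤ × ℤ, (((p.1 : ℝ) ^ 2 + (a * p.2) ^ 2 : ℝ) : ℂ) ^ (-s) := by
  rw [← ((epsteinFEPair a ha).hasMellin (s := s) hs).2, ← tsum_mul_left]
  have hq : ∀ p : ℤ × ℤ, (p.1 : ℝ) ^ 2 + (a * p.2) ^ 2 = 0 ↔ p = 0 := fun p ↦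
    ⟨fun h ↦ by_contra fun hp ↦ (sq_add_sq_pos_of_ne_zero ha hp).ne' h, by rintro rfl; simp⟩
  have key := hasSum_mellin_pi_mul₀ (ι := ℤ × ℤ) (a := fun _ ↦ 1)
    (p := fun p ↦ (p.1 : ℝ) ^ 2 + (a * p.2) ^ 2)
    (F := fun t ↦ (epsteinFEPair a ha).f t - (epsteinFEPair a ha).f₀) (s := s)
    (fun p ↦ by positivity) (by linarith) (fun t ht ↦ ?_) ?_
  · rw [← key.tsum_eq]
    refine tsum_congr fun p ↦ ?_
    simp only [cpow_neg, mul_one, div_eq_mul_inv]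
  · have h := hasSum_ite_sub_hasSum (hasSum_ofReal.mpr (hasSum_theta_mul_theta ha ht)) 0
    simp only [hq, one_mul]
    simpa [epsteinFEPair] using h
  · refine (summable_sq_add_sq_rpow ha hs).congr fun p ↦ ?_
    rw [Real.rpow_neg (by positivity)]
    simp

theorem tsum_int_of_even {g : ℤ → ℂ} (hg : Summable g) (heven : ∀ n, g (-n) = g n) :
    ∑' n : ℤ, g n = g 0 + 2 * ∑' n : ℕ, g (n + 1) := by
  have h1 : Summable fun n : ℕ ↦ g n := hg.comp_injective Nat.cast_injective
  have h2 : Summable fun n : ℕ ↦ g (n + 1) := by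
    simpa using (summable_nat_add_iff 1).mpr h1
  have e : ∀ n : ℕ, g (-(n + 1)) = g (n + 1) := fun n ↦ heven _
  rw [tsum_of_nat_of_neg_add_one h1 (h2.congr fun n ↦ (e n).symm), h1.tsum_eq_zero_add]
  simp only [e]
  push_cast
  ring

open Complex in
theorem sq_cpow_neg {x : ℝ} (hx : 0 ≤ x) (s : ℂ) :
    ((x ^ 2 : ℝ) : ℂ) ^ (-s) = (x : ℂ) ^ (-(2 * s)) := by
  rw [ofReal_pow, ← cpow_nat_mul']
  · congr 1; push_cast; ring
  all_goals rw [arg_ofReal_of_nonneg hx]; linarith [Real.pi_pos]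

open Complex in
theorem tsum_nat_add_one_sq_cpow {a : ℝ} (ha : 0 < a) {s : ℂ} (hs : 1 < s.re) :
    ∑' n : ℕ, (((a * (n + 1)) ^ 2 : ℝ) : ℂ) ^ (-s) = (a : ℂ) ^ (-(2 * s)) * riemannZeta (2 * s) := by
  rw [zeta_eq_tsum_one_div_nat_add_one_cpow (by simp; linarith), ← tsum_mul_left]
  refine tsum_congr fun n ↦ ?_
  rw [sq_cpow_neg (by positivity), ofReal_mul, mul_cpow_ofReal_nonneg ha.le (by positivity),
    one_div, ← cpow_neg]
  push_cast
  rfl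

open Complex in
theorem summable_int_nat_sq_add_sq_cpow {a : ℝ} (ha : 0 < a) {s : ℂ} (hs : 1 < s.re) :
    Summable (fun p : ℤ × ℕ ↦ (((p.1 : ℝ) ^ 2 + (a * (p.2 + 1)) ^ 2 : ℝ) : ℂ) ^ (-s)) := by
  have hi : Function.Injective (fun p : ℤ × ℕ ↦ ((p.1, (p.2 : ℤ) + 1) : ℤ × ℤ)) := by
    rintro ⟨m, n⟩ ⟨m', n'⟩ h
    simpa using h
  refine ((summable_sq_add_sq_cpow ha hs).comp_injective hi).congr fun p ↦ ?_
  simp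

open Complex in
theorem summable_nat_nat_sq_add_sq_cpow {a : ℝ} (ha : 0 < a) {s : ℂ} (hs : 1 < s.re) :
    Summable (fun p : ℕ × ℕ ↦ (((p.1 : ℝ) ^ 2 + (a * (p.2 + 1)) ^ 2 : ℝ) : ℂ) ^ (-s)) := by
  have hi : Function.Injective (fun p : ℕ × ℕ ↦ (((p.1 : ℤ), p.2) : ℤ × ℕ)) := by
    rintro ⟨m, n⟩ ⟨m', n'⟩ h
    simpa using h
  refine ((summable_int_nat_sq_add_sq_cpow ha hs).comp_injective hi).congr fun p ↦ ?_
  simp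

open Complex in
/-- Splitting the sum over `ℤ × ℤ` according to the sign of the second variable. -/
theorem tsum_int_int_sq_add_sq_cpow {a : ℝ} (ha : 0 < a) {s : ℂ} (hs : 1 < s.re) :
    ∑' p : ℤ × ℤ, (((p.1 : ℝ) ^ 2 + (a * p.2) ^ 2 : ℝ) : ℂ) ^ (-s) =
      2 * riemannZeta (2 * s) +
        2 * ∑' p : ℤ × ℕ, (((p.1 : ℝ) ^ 2 + (a * (p.2 + 1)) ^ 2 : ℝ) : ℂ) ^ (-s) := by
  have hs0 : s ≠ 0 := by rintro rfl; simp at hs; linarith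
  have hS := summable_sq_add_sq_cpow ha hs
  have hT := summable_int_nat_sq_add_sq_cpow ha hs
  have h0 : Summable fun m : ℤ ↦ (((m : ℝ) ^ 2 : ℝ) : ℂ) ^ (-s) := by
    refine (hS.comp_injective (Prod.mk_left_injective (0 : ℤ))).congr fun m ↦ ?_
    simp
  have hz : ∑' m : ℤ, (((m : ℝ) ^ 2 : ℝ) : ℂ) ^ (-s) = 2 * riemannZeta (2 * s) := by
    rw [tsum_int_of_even h0 (fun n ↦ by simp)]
    have h := tsum_nat_add_one_sq_cpow one_pos hs
    simp only [one_mul, ofReal_one, one_cpow] at h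
    rw [← h]
    simp [hs0]
  rw [hS.tsum_prod, hT.tsum_prod, ← hz, ← tsum_mul_left, ← h0.tsum_add (hT.prod.mul_left 2)]
  refine tsum_congr fun m ↦ ?_
  have h := tsum_int_of_even (hS.prod_factor m) (fun n ↦ by simp)
  simpa using h

open Complex in
/-- Splitting the sum over `ℤ × ℕ` according to the sign of the first variable. -/
theorem tsum_int_nat_sq_add_sq_cpow {a : ℝ} (ha : 0 < a) {s : ℂ} (hs : 1 < s.re) :
    ∑' p : ℤ × ℕ, (((p.1 : ℝ) ^ 2 + (a * (p.2 + 1)) ^ 2 : ℝ) : ℂ) ^ (-s) =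
      2 * ∑' p : ℕ × ℕ, (((p.1 : ℝ) ^ 2 + (a * (p.2 + 1)) ^ 2 : ℝ) : ℂ) ^ (-s) -
        (a : ℂ) ^ (-(2 * s)) * riemannZeta (2 * s) := by
  have hS := (summable_int_nat_sq_add_sq_cpow ha hs).prod_symm
  have hT := (summable_nat_nat_sq_add_sq_cpow ha hs).prod_symm
  have h0 : Summable fun n : ℕ ↦ (((a * (n + 1)) ^ 2 : ℝ) : ℂ) ^ (-s) := by
    refine (hS.comp_injective (Prod.mk_left_injective (0 : ℤ))).congr fun m ↦ ?_
    simp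
  rw [← (Equiv.prodComm ℕ ℤ).tsum_eq, ← (Equiv.prodComm ℕ ℕ).tsum_eq]
  simp only [Equiv.prodComm_apply]
  rw [hS.tsum_prod, hT.tsum_prod, ← tsum_nat_add_one_sq_cpow ha hs, ← tsum_mul_left,
    ← (hT.prod.mul_left 2).tsum_sub h0]
  refine tsum_congr fun n ↦ ?_
  have h := tsum_int_of_even (hS.prod_factor n) (fun n ↦ by simp)
  have h' := (hT.prod_factor n).tsum_eq_zero_add
  simp only [Prod.fst_swap, Prod.snd_swap] at h h' ⊢
  rw [h, h']
  push_cast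
  simp
  ring

open Complex in
/-- The continuation of the Epstein zeta function of `m² + (a n)²`, regular at `0`. -/
noncomputable def epsteinZeta (a : ℝ) (ha : 0 < a) (s : ℂ) : ℂ :=
  Real.pi ^ s * (Gamma (s + 1))⁻¹ *
    (s * (epsteinFEPair a ha).Λ₀ s - 1 - s * ((a : ℂ)⁻¹ / (1 - s)))

open Complex in
theorem differentiableAt_epsteinZeta {a : ℝ} (ha : 0 < a) {s : ℂ} (hs : s ≠ 1) :
    DifferentiableAt ℂ (epsteinZeta a ha) s := by
  have h1 : DifferentiableAt ℂ (fun s : ℂ ↦ (Gamma (s + 1))⁻¹) s :=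
    (differentiable_one_div_Gamma.comp (differentiable_id.add_const 1)) s
  have h2 : DifferentiableAt ℂ (fun s : ℂ ↦ (Real.pi : ℂ) ^ s) s :=
    differentiableAt_id.const_cpow (Or.inl (by simp [Real.pi_ne_zero]))
  have h3 := (epsteinFEPair a ha).differentiable_Λ₀ s
  have h4 : 1 - s ≠ 0 := sub_ne_zero.mpr hs.symm
  unfold epsteinZeta
  fun_prop (disch := assumption)

open Complex in
theorem epsteinZeta_eq_tsum {a : ℝ} (ha : 0 < a) {s : ℂ} (hs : 1 < s.re) :
    epsteinZeta a ha s =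
      ∑' p : ℤ × ℤ, (((p.1 : ℝ) ^ 2 + (a * p.2) ^ 2 : ℝ) : ℂ) ^ (-s) := by
  have hs0 : s ≠ 0 := by rintro rfl; simp at hs; linarith
  have hs1 : 1 - s ≠ 0 := sub_ne_zero.mpr (by rintro rfl; simp at hs)
  have hG : Gamma s ≠ 0 := Gamma_ne_zero_of_re_pos (by linarith)
  have hpi : (Real.pi : ℂ) ^ s ≠ 0 := by simp [cpow_eq_zero_iff, Real.pi_ne_zero]
  have h := epsteinFEPair_Λ_eq ha hs
  rw [epsteinZeta, WeakFEPair.Λ₀_eq, h, Gamma_add_one s hs0, cpow_neg]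
  simp only [epsteinFEPair, smul_eq_mul, ofReal_one]
  field_simp
  ring

open Complex in
theorem hasDerivAt_cpow_mul_riemannZeta_zero {a : ℝ} (ha : 0 < a) :
    HasDerivAt (fun s : ℂ ↦ (a : ℂ) ^ (-(2 * s)) * riemannZeta (2 * s))
      ((Real.log a - Real.log (2 * Real.pi) : ℝ) : ℂ) 0 := by
  have ha' : (a : ℂ) ≠ 0 := ofReal_ne_zero.mpr ha.ne'
  have hl : HasDerivAt (fun s : ℂ ↦ 2 * s) 2 0 := by
    simpa using (hasDerivAt_id (0 : ℂ)).const_mul 2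
  have h1 : HasDerivAt (fun s : ℂ ↦ (a : ℂ) ^ (-(2 * s))) (-(2 * log a)) 0 := by
    have h := hl.neg.const_cpow (c := (a : ℂ)) (Or.inl ha')
    refine h.congr_deriv ?_
    simp
    ring
  have h2 : HasDerivAt riemannZeta (-log (2 * Real.pi) / 2) (2 * 0) := by
    rw [mul_zero, ← deriv_riemannZeta_zero]
    exact (differentiableAt_riemannZeta zero_ne_one).hasDerivAt
  refine (h1.mul (h2.comp 0 hl)).congr_deriv ?_
  have e : ((Real.log (2 * Real.pi) : ℝ) : ℂ) = log (2 * Real.pi) := by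
    rw [ofReal_log (by positivity)]
    push_cast
    rfl
  rw [ofReal_sub, e, ofReal_log ha.le]
  simp [riemannZeta_zero]
  ring

/-- Relation between the zeta-regularized determinants of the Dirichlet Laplacian
on the annulus (`m ∈ ℤ`, `n ≥ 1`) and the mixed-boundary-condition Laplacian on the
half-annulus (`m ≥ 0`, `n ≥ 1`): `F_full′(0) = 2 F_half′(0) + log(4πℓ)`. -/
theorem det_annulus_halfAnnulus_relation (δ : ℝ) (hδ : δ ∈ Set.Ioo (0:ℝ) 1) (ℓ : ℝ)
    (hℓ : ℓ = Real.log (1/δ) / (2 * Real.pi)) :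
    (∀ s : ℂ, 1 < s.re →
      Summable (fun p : ℤ × ℕ =>
        ‖((((p.1 : ℝ))^2 + (((p.2 : ℝ) + 1) / (2 * ℓ))^2 : ℝ) : ℂ) ^ (-s)‖) ∧
      Summable (fun p : ℕ × ℕ =>
        ‖((((p.1 : ℝ))^2 + (((p.2 : ℝ) + 1) / (2 * ℓ))^2 : ℝ) : ℂ) ^ (-s)‖)) ∧
    ∃ ε : ℝ, 0 < ε ∧ ∃ Ffull Fhalf : ℂ → ℂ,
      DifferentiableOn ℂ Ffull ({s : ℂ | -ε < s.re} \ {1/2, 1}) ∧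
      DifferentiableOn ℂ Fhalf ({s : ℂ | -ε < s.re} \ {1/2, 1}) ∧
      (∀ s : ℂ, 1 < s.re →
        Ffull s = ∑' p : ℤ × ℕ,
          ((((p.1 : ℝ))^2 + (((p.2 : ℝ) + 1) / (2 * ℓ))^2 : ℝ) : ℂ) ^ (-s)) ∧
      (∀ s : ℂ, 1 < s.re →
        Fhalf s = ∑' p : ℕ × ℕ,
          ((((p.1 : ℝ))^2 + (((p.2 : ℝ) + 1) / (2 * ℓ))^2 : ℝ) : ℂ) ^ (-s)) ∧
      deriv Ffull 0 = 2 * deriv Fhalf 0 + (Real.log (4 * Real.pi * ℓ) : ℂ) ∧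
      Complex.exp (-(deriv Fhalf 0)) =
        (Real.sqrt (4 * Real.pi * ℓ) : ℂ) * Complex.exp (-(deriv Ffull 0) / 2) := by
  obtain ⟨hδ0, hδ1⟩ := hδ
  have hlog : 0 < Real.log (1 / δ) :=
    Real.log_pos (by rw [one_div]; exact (one_lt_inv₀ hδ0).mpr hδ1)
  have hℓ0 : 0 < ℓ := by rw [hℓ]; positivity
  clear hℓ hlog
  obtain ⟨a, ha_def⟩ : ∃ a : ℝ, a = (2 * ℓ)⁻¹ := ⟨_, rfl⟩
  have ha : 0 < a := by rw [ha_def]; positivity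
  have hdiv : ∀ x : ℝ, x / (2 * ℓ) = a * x := fun x ↦ by rw [ha_def, div_eq_inv_mul]
  simp only [hdiv]
  refine ⟨fun s hs ↦ ⟨(summable_int_nat_sq_add_sq_cpow ha hs).norm,
    (summable_nat_nat_sq_add_sq_cpow ha hs).norm⟩, 1, one_pos, ?_⟩
  set Z : ℂ → ℂ := fun s ↦ (a : ℂ) ^ (-(2 * s)) * riemannZeta (2 * s) with hZ
  set F : ℂ → ℂ := fun s ↦ epsteinZeta a ha s / 2 - riemannZeta (2 * s) with hF
  have hζ : ∀ s : ℂ, s ≠ 1 / 2 → DifferentiableAt ℂ (fun s ↦ riemannZeta (2 * s)) s := by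
    intro s hs
    refine (differentiableAt_riemannZeta fun h ↦ hs ?_).comp s (by fun_prop)
    linear_combination h / 2
  have hFd : ∀ s : ℂ, s ≠ 1 / 2 → s ≠ 1 → DifferentiableAt ℂ F s := fun s h h' ↦
    ((differentiableAt_epsteinZeta ha h').div_const 2).sub (hζ s h)
  have hZd : ∀ s : ℂ, s ≠ 1 / 2 → DifferentiableAt ℂ Z s := by
    intro s h
    refine DifferentiableAt.mul ?_ (hζ s h)
    exact DifferentiableAt.const_cpow (by fun_prop)
      (Or.inl (Complex.ofReal_ne_zero.mpr ha.ne'))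
  have hHd : ∀ s : ℂ, s ≠ 1 / 2 → s ≠ 1 → DifferentiableAt ℂ (fun s ↦ (F s + Z s) / 2) s :=
    fun s h h' ↦ ((hFd s h h').add (hZd s h)).div_const 2
  have hFs : ∀ s : ℂ, 1 < s.re → F s =
      ∑' p : ℤ × ℕ, (((p.1 : ℝ) ^ 2 + (a * (p.2 + 1)) ^ 2 : ℝ) : ℂ) ^ (-s) := by
    intro s hs
    rw [hF]
    simp only
    rw [epsteinZeta_eq_tsum ha hs, tsum_int_int_sq_add_sq_cpow ha hs]
    ring
  have hderiv : deriv F 0 =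
      2 * deriv (fun s ↦ (F s + Z s) / 2) 0 + (Real.log (4 * Real.pi * ℓ) : ℂ) := by
    have hZ0 := hasDerivAt_cpow_mul_riemannZeta_zero ha
    have hF0 := (hFd 0 (by norm_num) zero_ne_one).hasDerivAt
    have hH0 := (hF0.add hZ0).div_const 2
    rw [show deriv (fun s ↦ (F s + Z s) / 2) 0 = _ from hH0.deriv]
    have hl : Real.log a - Real.log (2 * Real.pi) = -Real.log (4 * Real.pi * ℓ) := by
      rw [ha_def, Real.log_inv, show 4 * Real.pi * ℓ = (2 * ℓ) * (2 * Real.pi) by ring,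
        Real.log_mul (x := 2 * ℓ) (by positivity) (by positivity)]
      ring
    rw [hl]
    push_cast
    ring
  refine ⟨F, fun s ↦ (F s + Z s) / 2, ?_, ?_, hFs, ?_, hderiv, ?_⟩
  · rintro s ⟨-, hs⟩
    simp only [Set.mem_insert_iff, Set.mem_singleton_iff, not_or] at hs
    exact (hFd s hs.1 hs.2).differentiableWithinAt
  · rintro s ⟨-, hs⟩
    simp only [Set.mem_insert_iff, Set.mem_singleton_iff, not_or] at hs
    exact (hHd s hs.1 hs.2).differentiableWithinAt
  · intro s hs
    simp only
    rw [hFs s hs, tsum_int_nat_sq_add_sq_cpow ha hs]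
    ring
  · have hsqrt : (Real.sqrt (4 * Real.pi * ℓ) : ℂ) =
        Complex.exp ((Real.log (4 * Real.pi * ℓ) : ℂ) / 2) := by
      rw [Real.sqrt_eq_rpow, Real.rpow_def_of_pos (by positivity)]
      push_cast
      congr 1
      ring
    rw [hderiv, hsqrt, ← Complex.exp_add]
    congr 1
    ring
end
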